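/- arXiv:0904.4927 — 2 statements merged into one kernel-verified Lean document; each statement's English description precedes it below -/
import Mathlib

section
/- For every integer r ≥ 2, all positive integers h, b₁, b₂, and every ε > 0, there exists an integer m̃, depending only on r, h, b₁, b₂ and ε, such that for every (b₁,b₂)-colored 𝔯-partite graph G on Ω there is an integer m ≤ m̃ with E_{φ∈Φ(m)}[reg_h(G/φ)] ≤ ε, where φ ∈ Φ(m) is a random partitionwise map. -/
open Finset
open scoped BigOperators Classical

/-! ## Framework: colored partite graphs, complexes, partitionwise maps,
regularization, relative densities and regularity (Ishigami's setting). -/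

/-- Partitionwise maps `Φ(h)`: `h` sample vertices in each of the `r` parts. -/
abbrev PMap {r : ℕ} (Ω : Fin r → Type) (h : ℕ) : Type := ∀ i : Fin r, Fin h → Ω i

/-- The product weight of a partitionwise map (each sample independent). -/
noncomputable def pmapWeight {r : ℕ} (Ω : Fin r → Type) [∀ i, Fintype (Ω i)]
    (w : ∀ i, Ω i → ℝ) {h : ℕ} (φ : PMap Ω h) : ℝ :=
  ∏ i : Fin r, ∏ a : Fin h, w i (φ i a)

/-- Expectation over a random partitionwise map in `Φ(h)`. -/
noncomputable def EPhi {r : ℕ} (Ω : Fin r → Type) [∀ i, Fintype (Ω i)]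
    (w : ∀ i, Ω i → ℝ) (h : ℕ) (f : PMap Ω h → ℝ) : ℝ :=
  ∑ φ : PMap Ω h, pmapWeight Ω w φ * f φ

/-- Conditional expectation over a random partitionwise map in `Φ(h)`. -/
noncomputable def EPhiCond {r : ℕ} (Ω : Fin r → Type) [∀ i, Fintype (Ω i)]
    (w : ∀ i, Ω i → ℝ) (h : ℕ) (A : PMap Ω h → Prop) (f : PMap Ω h → ℝ) : ℝ :=
  (∑ φ : PMap Ω h, if A φ then pmapWeight Ω w φ * f φ else 0) /
  (∑ φ : PMap Ω h, if A φ then pmapWeight Ω w φ else 0)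

/-- A colored `𝔯`-partite graph on vertex sets `Ω i`: color sets `C1 i` (for vertices,
i.e. index-`{i}` edges) and `C2 i j` (for index-`{i,j}` edges), together with coloring
maps, symmetric in the two endpoints. -/
structure CGraph {r : ℕ} (Ω : Fin r → Type) (K₁ K₂ : Type) where
  C1 : Fin r → Finset K₁
  C2 : Fin r → Fin r → Finset K₂
  vCol : ∀ i, Ω i → K₁
  eCol : ∀ i j, Ω i → Ω j → K₂
  eSymm : ∀ i j x y, eCol i j x y = eCol j i y x
  c2Symm : ∀ i j, C2 i j = C2 j i
  vMem : ∀ i x, vCol i x ∈ C1 i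
  eMem : ∀ i j x y, eCol i j x y ∈ C2 i j

/-- `G` is `(b₁,b₂)`-colored: each color set `C_I` has at most `b_{|I|}` elements. -/
def CGraph.Bounded {r : ℕ} {Ω : Fin r → Type} {K₁ K₂ : Type}
    (G : CGraph Ω K₁ K₂) (b₁ b₂ : ℕ) : Prop :=
  (∀ i, (G.C1 i).card ≤ b₁) ∧ ∀ i j, i ≠ j → (G.C2 i j).card ≤ b₂

/-- Relative density `d_G(c)` of a vertex (index-`{i}`) total color `c`:
the probability that a random vertex of `Ω i` has color `c`. -/
noncomputable def dV {r : ℕ} (Ω : Fin r → Type) [∀ i, Fintype (Ω i)]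
    (w : ∀ i, Ω i → ℝ) {K₁ K₂ : Type} (G : CGraph Ω K₁ K₂) (i : Fin r) (c : K₁) : ℝ :=
  ∑ x : Ω i, if G.vCol i x = c then w i x else 0

/-- Relative density `d_G(c₂; ci, cj)` of an index-`{i,j}` total color:
the conditional probability that a random edge has color `c₂` given that its
endpoints have colors `ci`, `cj`. -/
noncomputable def dE {r : ℕ} (Ω : Fin r → Type) [∀ i, Fintype (Ω i)]
    (w : ∀ i, Ω i → ℝ) {K₁ K₂ : Type} (G : CGraph Ω K₁ K₂) (i j : Fin r)
    (c₂ : K₂) (ci cj : K₁) : ℝ :=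
  (∑ x : Ω i, ∑ y : Ω j,
      if G.eCol i j x y = c₂ ∧ G.vCol i x = ci ∧ G.vCol j y = cj then w i x * w j y else 0) /
  (∑ x : Ω i, ∑ y : Ω j, if G.vCol i x = ci ∧ G.vCol j y = cj then w i x * w j y else 0)

/-- A (simplicial) complex with `h` vertices in each of the `r` parts: a colored
partite graph where `none` is the (unique) invisible color of each index, and any
edge containing an invisible vertex is invisible. -/
structure SComplex (r h : ℕ) (K₁ K₂ : Type) where
  vCol : Fin r → Fin h → Option K₁
  eCol : Fin r → Fin r → Fin h → Fin h → Option K₂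
  eSymm : ∀ i j a b, eCol i j a b = eCol j i b a
  loopless : ∀ i a b, eCol i i a b = none
  down : ∀ i j a b, vCol i a = none → eCol i j a b = none

/-- `S ∈ S_{h,G}` : the visible colors of the complex `S` are (identified with)
colors of `G`. -/
def SComplex.MemS {r h : ℕ} {Ω : Fin r → Type} {K₁ K₂ : Type}
    (S : SComplex r h K₁ K₂) (G : CGraph Ω K₁ K₂) : Prop :=
  (∀ i a c, S.vCol i a = some c → c ∈ G.C1 i) ∧
  (∀ i j a b c, S.eCol i j a b = some c → c ∈ G.C2 i j)

/-- `𝕍₁(S)`: the visible vertices of `S`. -/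
noncomputable def V1 {r h : ℕ} {K₁ K₂ : Type} (S : SComplex r h K₁ K₂) :
    Finset (Fin r × Fin h) :=
  univ.filter fun p => S.vCol p.1 p.2 ≠ none

/-- `𝕍₂(S)`: the visible (size-2) edges of `S`, listed once each (`i < j`). -/
noncomputable def V2 {r h : ℕ} {K₁ K₂ : Type} (S : SComplex r h K₁ K₂) :
    Finset (Fin r × Fin r × Fin h × Fin h) :=
  univ.filter fun q => q.1 < q.2.1 ∧ S.eCol q.1 q.2.1 q.2.2.1 q.2.2.2 ≠ none

/-- `d_G(S⟨v⟩)` for a vertex `v` of `S` (junk value `1` on invisible vertices). -/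
noncomputable def dVS {r h : ℕ} (Ω : Fin r → Type) [∀ i, Fintype (Ω i)]
    (w : ∀ i, Ω i → ℝ) {K₁ K₂ : Type} (G : CGraph Ω K₁ K₂)
    (S : SComplex r h K₁ K₂) (p : Fin r × Fin h) : ℝ :=
  match S.vCol p.1 p.2 with
  | some c => dV Ω w G p.1 c
  | none => 1

/-- `d_G(S⟨e⟩)` for a size-2 edge `e` of `S` (junk value `1` on invisible edges). -/
noncomputable def dES {r h : ℕ} (Ω : Fin r → Type) [∀ i, Fintype (Ω i)]
    (w : ∀ i, Ω i → ℝ) {K₁ K₂ : Type} (G : CGraph Ω K₁ K₂)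
    (S : SComplex r h K₁ K₂) (q : Fin r × Fin r × Fin h × Fin h) : ℝ :=
  match S.eCol q.1 q.2.1 q.2.2.1 q.2.2.2, S.vCol q.1 q.2.2.1, S.vCol q.2.1 q.2.2.2 with
  | some c₂, some ci, some cj => dE Ω w G q.1 q.2.1 c₂ ci cj
  | _, _, _ => 1

/-- The event `G(φ(v)) = S(v)` for all visible vertices `v` of `S`. -/
def vEvent {r h : ℕ} {Ω : Fin r → Type} {K₁ K₂ : Type} (G : CGraph Ω K₁ K₂)
    (S : SComplex r h K₁ K₂) (φ : PMap Ω h) : Prop :=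
  ∀ p ∈ V1 S, some (G.vCol p.1 (φ p.1 p.2)) = S.vCol p.1 p.2

/-- The event `G(φ(e)) = S(e)` for all visible size-2 edges `e` of `S`. -/
def eEvent {r h : ℕ} {Ω : Fin r → Type} {K₁ K₂ : Type} (G : CGraph Ω K₁ K₂)
    (S : SComplex r h K₁ K₂) (φ : PMap Ω h) : Prop :=
  ∀ q ∈ V2 S, some (G.eCol q.1 q.2.1 (φ q.1 q.2.2.1) (φ q.2.1 q.2.2.2)) =
    S.eCol q.1 q.2.1 q.2.2.1 q.2.2.2

/-- `P_{φ∈Φ(h)}[G(φ(e)) = S(e) for all e ∈ 𝕍(S)]`. -/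
noncomputable def countProb {r h : ℕ} (Ω : Fin r → Type) [∀ i, Fintype (Ω i)]
    (w : ∀ i, Ω i → ℝ) {K₁ K₂ : Type} (G : CGraph Ω K₁ K₂)
    (S : SComplex r h K₁ K₂) : ℝ :=
  EPhi Ω w h fun φ => if vEvent G S φ ∧ eEvent G S φ then 1 else 0

/-- Value of an error function `δ` (defined on index-2 total colors) at `S⟨e⟩`. -/
noncomputable def deltaS {r h : ℕ} {K₁ K₂ : Type} (δ : Fin r → Fin r → K₂ → K₁ → K₁ → ℝ)
    (S : SComplex r h K₁ K₂) (q : Fin r × Fin r × Fin h × Fin h) : ℝ :=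
  match S.eCol q.1 q.2.1 q.2.2.1 q.2.2.2, S.vCol q.1 q.2.2.1, S.vCol q.2.1 q.2.2.2 with
  | some c₂, some ci, some cj => δ q.1 q.2.1 c₂ ci cj
  | _, _, _ => 0

/-- The counting equation (\ref{lj19}) for one complex `S`:
`P[G(φ(e)) = S(e) ∀ e ∈ 𝕍(S)] = ∏_{v∈𝕍₁(S)} d_G(S⟨v⟩) · ∏_{e∈𝕍₂(S)} (d_G(S⟨e⟩) ±̇ δ(S⟨e⟩))`,
where `a ±̇ b` denotes a suitable number `c` with `max 0 (a-b) ≤ c ≤ min 1 (a+b)`. -/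
def CountEqAt {r h : ℕ} (Ω : Fin r → Type) [∀ i, Fintype (Ω i)]
    (w : ∀ i, Ω i → ℝ) {K₁ K₂ : Type} (G : CGraph Ω K₁ K₂)
    (δ : Fin r → Fin r → K₂ → K₁ → K₁ → ℝ) (S : SComplex r h K₁ K₂) : Prop :=
  ∃ c : Fin r × Fin r × Fin h × Fin h → ℝ,
    (∀ q ∈ V2 S, max 0 (dES Ω w G S q - deltaS δ S q) ≤ c q ∧
        c q ≤ min 1 (dES Ω w G S q + deltaS δ S q)) ∧
    countProb Ω w G S = (∏ p ∈ V1 S, dVS Ω w G S p) * ∏ q ∈ V2 S, c q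

/-- `δ` is an `h`-error function of `G`: the counting equation holds for every
`S ∈ S_{h,G}`. -/
def IsErrorFun {r : ℕ} (Ω : Fin r → Type) [∀ i, Fintype (Ω i)]
    (w : ∀ i, Ω i → ℝ) {K₁ K₂ : Type} (G : CGraph Ω K₁ K₂) (h : ℕ)
    (δ : Fin r → Fin r → K₂ → K₁ → K₁ → ℝ) : Prop :=
  ∀ S : SComplex r h K₁ K₂, S.MemS G → CountEqAt Ω w G δ S

/-- `E_{e∈Ω_I}[δ(G⟨e⟩)]` for `I = {i,j}`. -/
noncomputable def EdgeDeltaAvg {r : ℕ} (Ω : Fin r → Type) [∀ i, Fintype (Ω i)]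
    (w : ∀ i, Ω i → ℝ) {K₁ K₂ : Type} (G : CGraph Ω K₁ K₂)
    (δ : Fin r → Fin r → K₂ → K₁ → K₁ → ℝ) (i j : Fin r) : ℝ :=
  ∑ x : Ω i, ∑ y : Ω j,
    w i x * w j y * δ i j (G.eCol i j x y) (G.vCol i x) (G.vCol j y)

/-- `G` is `(ε,h)`-regular. -/
def IsRegularG {r : ℕ} (Ω : Fin r → Type) [∀ i, Fintype (Ω i)]
    (w : ∀ i, Ω i → ℝ) {K₁ K₂ : Type} (G : CGraph Ω K₁ K₂) (h : ℕ) (ε : ℝ) : Prop :=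
  ∃ δ : Fin r → Fin r → K₂ → K₁ → K₁ → ℝ,
    (∀ i j c₂ ci cj, 0 ≤ δ i j c₂ ci cj) ∧
    IsErrorFun Ω w G h δ ∧
    ∀ i j : Fin r, i ≠ j → EdgeDeltaAvg Ω w G δ i j ≤ ε / (G.C2 i j).card

/-- `reg_h(G)`: the minimum `ε` such that `G` is `(ε,h)`-regular. -/
noncomputable def reg {r : ℕ} (Ω : Fin r → Type) [∀ i, Fintype (Ω i)]
    (w : ∀ i, Ω i → ℝ) {K₁ K₂ : Type} (G : CGraph Ω K₁ K₂) (h : ℕ) : ℝ :=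
  sInf {ε : ℝ | IsRegularG Ω w G h ε}

/-- The regularization `G/φ` of `G` by a partitionwise map `φ ∈ Φ(m)`: each vertex
`v ∈ Ω i` is recolored by its original color together with the colors of all edges
joining `v` to the sample points of `φ` in the other parts. Size-2 edges keep
their colors. -/
noncomputable def regz {r : ℕ} (Ω : Fin r → Type) [∀ i, Fintype (Ω i)]
    {K₁ K₂ : Type} [Fintype K₁] [Fintype K₂] (G : CGraph Ω K₁ K₂) {m : ℕ}
    (φ : PMap Ω m) : CGraph Ω (K₁ × (Fin r → Fin m → Option K₂)) K₂ where
  C1 i := univ.filter fun p : K₁ × (Fin r → Fin m → Option K₂) =>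
    p.1 ∈ G.C1 i ∧ ∀ j b, if j = i then p.2 j b = none
      else ∃ c ∈ G.C2 i j, p.2 j b = some c
  C2 := G.C2
  vCol i x := (G.vCol i x, fun j b => if j = i then none else some (G.eCol i j x (φ j b)))
  eCol := G.eCol
  eSymm := G.eSymm
  c2Symm := G.c2Symm
  vMem := by
    intro i x
    simp only [mem_filter, mem_univ, true_and]
    refine ⟨G.vMem i x, fun j b => ?_⟩
    by_cases hj : j = i
    · simp [hj]
    · simp only [hj, if_neg hj]
      exact ⟨G.eCol i j x (φ j b), G.eMem i j x (φ j b), rfl⟩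
  eMem := G.eMem

/-- Conditional expectation of `f` over a random pair `e = (x,y) ∈ Ω_{i} × Ω_{j}`
given the event `A`. -/
noncomputable def condEE {r : ℕ} (Ω : Fin r → Type) [∀ i, Fintype (Ω i)]
    (w : ∀ i, Ω i → ℝ) (i j : Fin r) (A : Ω i → Ω j → Prop) (f : Ω i → Ω j → ℝ) : ℝ :=
  (∑ x : Ω i, ∑ y : Ω j, if A x y then w i x * w j y * f x y else 0) /
  (∑ x : Ω i, ∑ y : Ω j, if A x y then w i x * w j y else 0)

/-- `e ≈_{∂(G/ψ)} e'` : the two pairs have the same frame color in the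
regularization `G/ψ`. -/
def frameRel {r : ℕ} (Ω : Fin r → Type) [∀ i, Fintype (Ω i)]
    {K₁ K₂ : Type} [Fintype K₁] [Fintype K₂] (G : CGraph Ω K₁ K₂) {m : ℕ}
    (ψ : PMap Ω m) (i j : Fin r) (x : Ω i) (y : Ω j) (x' : Ω i) (y' : Ω j) : Prop :=
  (regz Ω G ψ).vCol i x = (regz Ω G ψ).vCol i x' ∧
  (regz Ω G ψ).vCol j y = (regz Ω G ψ).vCol j y'

/-- `η(c₂; ci, cj)` (eq. (\ref{061220})) computed in `G`, with `N` random sample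
vertices in each part (`N = M·h` in the paper). -/
noncomputable def eta {r : ℕ} (Ω : Fin r → Type) [∀ i, Fintype (Ω i)]
    (w : ∀ i, Ω i → ℝ) {K₁ K₂ : Type} [Fintype K₁] [Fintype K₂]
    (G : CGraph Ω K₁ K₂) (N : ℕ) (i j : Fin r) (c₂ : K₂) (ci cj : K₁) : ℝ :=
  EPhi Ω w N fun ψ =>
    condEE Ω w i j (fun x' y' => G.vCol i x' = ci ∧ G.vCol j y' = cj) fun x' y' =>
      (condEE Ω w i j (fun x y => frameRel Ω G ψ i j x y x' y')
          (fun x y => if G.eCol i j x y = c₂ then 1 else 0) -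
        dE Ω w G i j c₂ ci cj) ^ 2

/-- `η(S⟨e⟩)` for a size-2 edge of a complex `S` (junk value `0` if invisible). -/
noncomputable def etaS {r h : ℕ} (Ω : Fin r → Type) [∀ i, Fintype (Ω i)]
    (w : ∀ i, Ω i → ℝ) {K₁ K₂ : Type} [Fintype K₁] [Fintype K₂]
    (G : CGraph Ω K₁ K₂) (N : ℕ) (S : SComplex r h K₁ K₂)
    (q : Fin r × Fin r × Fin h × Fin h) : ℝ :=
  match S.eCol q.1 q.2.1 q.2.2.1 q.2.2.2, S.vCol q.1 q.2.2.1, S.vCol q.2.1 q.2.2.2 with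
  | some c₂, some ci, some cj => eta Ω w G N q.1 q.2.1 c₂ ci cj
  | _, _, _ => 0

/-- `ε₁ := (ε/(6 b₂ binom(r,2)))²`. -/
noncomputable def eps1 (r b₂ : ℕ) (ε : ℝ) : ℝ := (ε / (6 * b₂ * r.choose 2)) ^ 2

/-- `C := √2 · binom(r,2) h² · (b₂/√ε₁)^{binom(r,2)h² − 1}`. -/
noncomputable def Cconst (r h b₂ : ℕ) (ε : ℝ) : ℝ :=
  Real.sqrt 2 * r.choose 2 * h ^ 2 *
    ((b₂ : ℝ) / Real.sqrt (eps1 r b₂ ε)) ^ (r.choose 2 * h ^ 2 - 1)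

/-- `M(m) := (b₁ b₂^{(r−1)m} / √ε₁)^{rh}` (as a sample count). -/
noncomputable def Mconst (r h b₁ b₂ : ℕ) (ε : ℝ) (m : ℕ) : ℕ :=
  ⌈(((b₁ : ℝ) * (b₂ : ℝ) ^ ((r - 1) * m)) / Real.sqrt (eps1 r b₂ ε)) ^ (r * h)⌉₊

/-- A vertex total color `c` of index `{i}` is bad. -/
def BadV {r : ℕ} (Ω : Fin r → Type) [∀ i, Fintype (Ω i)]
    (w : ∀ i, Ω i → ℝ) {K₁ K₂ : Type} (G : CGraph Ω K₁ K₂) (ε₁ : ℝ)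
    (i : Fin r) (c : K₁) : Prop :=
  dV Ω w G i c ≤ Real.sqrt ε₁ / (G.C1 i).card

/-- An index-`{i,j}` total color `(c₂; ci, cj)` is bad: some nonempty `I* ⊆ {i,j}`
has relative density at most `√ε₁/|C_{I*}|`. -/
def BadE {r : ℕ} (Ω : Fin r → Type) [∀ i, Fintype (Ω i)]
    (w : ∀ i, Ω i → ℝ) {K₁ K₂ : Type} (G : CGraph Ω K₁ K₂) (ε₁ : ℝ)
    (i j : Fin r) (c₂ : K₂) (ci cj : K₁) : Prop :=
  BadV Ω w G ε₁ i ci ∨ BadV Ω w G ε₁ j cj ∨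
    dE Ω w G i j c₂ ci cj ≤ Real.sqrt ε₁ / (G.C2 i j).card

/-- The error function `δ` of the paper: `1` on bad total colors, `C·√η` otherwise. -/
noncomputable def deltaDef {r : ℕ} (Ω : Fin r → Type) [∀ i, Fintype (Ω i)]
    (w : ∀ i, Ω i → ℝ) {K₁ K₂ : Type} [Fintype K₁] [Fintype K₂]
    (G : CGraph Ω K₁ K₂) (ε₁ Cc : ℝ) (N : ℕ)
    (i j : Fin r) (c₂ : K₂) (ci cj : K₁) : ℝ :=
  if BadE Ω w G ε₁ i j c₂ ci cj then 1 else Cc * Real.sqrt (eta Ω w G N i j c₂ ci cj)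

/-- `∏_{e∈D}(𝟙[G(φ(e)) = S(e)] − d_G(S⟨e⟩))`, single factor. -/
noncomputable def indMinusD {r h : ℕ} (Ω : Fin r → Type) [∀ i, Fintype (Ω i)]
    (w : ∀ i, Ω i → ℝ) {K₁ K₂ : Type} (G : CGraph Ω K₁ K₂)
    (S : SComplex r h K₁ K₂) (φ : PMap Ω h) (q : Fin r × Fin r × Fin h × Fin h) : ℝ :=
  (if some (G.eCol q.1 q.2.1 (φ q.1 q.2.2.1) (φ q.2.1 q.2.2.2)) =
      S.eCol q.1 q.2.1 q.2.2.1 q.2.2.2 then 1 else 0) - dES Ω w G S q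


namespace RL

section flat
variable {ι : Type} [Fintype ι] [DecidableEq ι] {T : ι → Type} [∀ k, Fintype (T k)]

/-- Expectation over a finite product space. -/
noncomputable def EE (w : ∀ k, T k → ℝ) (F : (∀ k, T k) → ℝ) : ℝ :=
  ∑ φ : (∀ k, T k), (∏ k, w k (φ k)) * F φ

lemma EE_prod (w : ∀ k, T k → ℝ) (f : ∀ k, T k → ℝ) :
    EE w (fun φ => ∏ k, f k (φ k)) = ∏ k, ∑ x, w k x * f k x := by
  unfold EE
  rw [Finset.prod_univ_sum]
  simp [Finset.prod_mul_distrib, Fintype.piFinset_univ]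

lemma EE_one (w : ∀ k, T k → ℝ) (hw1 : ∀ k, ∑ x, w k x = 1) :
    EE w (fun _ => 1) = 1 := by
  have := EE_prod w (fun _ _ => 1)
  simpa [hw1] using this

lemma EE_const (w : ∀ k, T k → ℝ) (hw1 : ∀ k, ∑ x, w k x = 1) (c : ℝ) :
    EE w (fun _ => c) = c := by
  have := EE_one w hw1
  unfold EE at *
  simp only [mul_one] at this
  rw [← Finset.sum_mul, this, one_mul]

lemma EE_mono (w : ∀ k, T k → ℝ) (hw : ∀ k x, 0 ≤ w k x) {F G : (∀ k, T k) → ℝ}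
    (h : ∀ φ, F φ ≤ G φ) : EE w F ≤ EE w G := by
  unfold EE
  apply Finset.sum_le_sum
  intro φ _
  exact mul_le_mul_of_nonneg_left (h φ) (Finset.prod_nonneg fun k _ => hw k _)

lemma EE_abs_le (w : ∀ k, T k → ℝ) (hw : ∀ k x, 0 ≤ w k x) {F G : (∀ k, T k) → ℝ}
    (h : ∀ φ, |F φ| ≤ G φ) : |EE w F| ≤ EE w G := by
  rw [abs_le]
  constructor
  · have : EE w (fun φ => - G φ) ≤ EE w F := EE_mono w hw (fun φ => (abs_le.1 (h φ)).1)
    have h2 : EE w (fun φ => - G φ) = - EE w G := by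
      unfold EE; simp
    linarith
  · exact EE_mono w hw (fun φ => (abs_le.1 (h φ)).2)

lemma EE_add (w : ∀ k, T k → ℝ) (F G : (∀ k, T k) → ℝ) :
    EE w (fun φ => F φ + G φ) = EE w F + EE w G := by
  unfold EE; simp [mul_add, Finset.sum_add_distrib]

lemma EE_mul_const (w : ∀ k, T k → ℝ) (F : (∀ k, T k) → ℝ) (c : ℝ) :
    EE w (fun φ => F φ * c) = EE w F * c := by
  unfold EE; simp [← mul_assoc, Finset.sum_mul]

lemma EE_resample (w : ∀ k, T k → ℝ) (hw1 : ∀ k, ∑ x, w k x = 1) (k : ι)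
    (F : (∀ k, T k) → ℝ) :
    EE w F = EE w (fun φ => ∑ x, w k x * F (Function.update φ k x)) := by
  have hW : ∀ (φ : ∀ k, T k) (x : T k), (∏ l, w l (Function.update φ k x l)) * w k (φ k)
      = (∏ l, w l (φ l)) * w k x := by
    intro φ x
    rw [← Finset.mul_prod_erase univ _ (Finset.mem_univ k),
      ← Finset.mul_prod_erase univ (fun l => w l (φ l)) (Finset.mem_univ k)]
    have : ∏ l ∈ univ.erase k, w l (Function.update φ k x l) = ∏ l ∈ univ.erase k, w l (φ l) := by
      apply Finset.prod_congr rfl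
      intro l hl
      rw [Function.update_of_ne (Finset.ne_of_mem_erase hl)]
    rw [this, Function.update_self]; ring
  unfold EE
  have e1 : ∑ φ : (∀ k, T k), (∏ l, w l (φ l)) * F φ
      = ∑ z : (∀ k, T k) × T k, (∏ l, w l (z.1 l)) * w k z.2 * F z.1 := by
    rw [Fintype.sum_prod_type]
    apply Finset.sum_congr rfl
    intro φ _
    simp only
    rw [← Finset.sum_mul, ← Finset.mul_sum, hw1, mul_one]
  have e2 : ∑ φ : (∀ k, T k), (∏ l, w l (φ l)) * ∑ x, w k x * F (Function.update φ k x)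
      = ∑ z : (∀ k, T k) × T k, (∏ l, w l (z.1 l)) * w k z.2 * F (Function.update z.1 k z.2) := by
    rw [Fintype.sum_prod_type]
    apply Finset.sum_congr rfl
    intro φ _
    rw [Finset.mul_sum]
    apply Finset.sum_congr rfl
    intro x _
    ring
  rw [e1, e2]
  let σ : (∀ k, T k) × T k → (∀ k, T k) × T k := fun z => (Function.update z.1 k z.2, z.1 k)
  have hσ : Function.Involutive σ := by
    intro z
    simp [σ]
  refine Fintype.sum_equiv hσ.toPerm _ _ ?_
  intro z
  simp only [Function.Involutive.coe_toPerm, σ, Function.update_idem, Function.update_eq_self]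
  rw [hW]

lemma EE_resample2 (w : ∀ k, T k → ℝ) (hw1 : ∀ k, ∑ x, w k x = 1) (k l : ι)
    (F : (∀ k, T k) → ℝ) :
    EE w F = EE w (fun φ => ∑ x, ∑ y, w k x * w l y *
      F (Function.update (Function.update φ k x) l y)) := by
  rw [EE_resample w hw1 l F, EE_resample w hw1 k]
  congr 1
  funext φ
  apply Finset.sum_congr rfl
  intro x _
  rw [Finset.mul_sum]
  apply Finset.sum_congr rfl
  intro y _
  ring

lemma EE_marginal2 (w : ∀ k, T k → ℝ) (hw1 : ∀ k, ∑ x, w k x = 1) (k l : ι) (hkl : k ≠ l)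
    (g : T k → T l → ℝ) :
    EE w (fun φ => g (φ k) (φ l)) = ∑ x, ∑ y, w k x * w l y * g x y := by
  rw [EE_resample2 w hw1 k l]
  rw [← EE_const w hw1 (∑ x, ∑ y, w k x * w l y * g x y)]
  congr 1
  funext φ
  apply Finset.sum_congr rfl
  intro x _
  apply Finset.sum_congr rfl
  intro y _
  rw [Function.update_self, Function.update_of_ne hkl, Function.update_self]

end flat

/-- First match lemma. -/
lemma first_match {Z : Type} [Fintype Z] (W : Z → ℝ) (hW : ∀ z, 0 ≤ W z) (hW1 : ∑ z, W z = 1)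
    (mt : Z → Prop) [DecidablePred mt] (n : Z → ℝ) :
    ∀ (M : ℕ) (N : (Fin M → Z) → ℝ), (∀ Ψ, 0 ≤ N Ψ) → (∀ Ψ k, mt (Ψ k) → n (Ψ k) ≤ N Ψ) →
      (∑ z, W z * (if mt z then n z else 0)) *
        ∑ k ∈ range M, (1 - ∑ z, W z * (if mt z then 1 else 0)) ^ k ≤
      ∑ Ψ : Fin M → Z, (∏ k, W (Ψ k)) * N Ψ := by
  set T := ∑ z, W z * (if mt z then n z else 0) with hT
  set p := ∑ z, W z * (if mt z then (1 : ℝ) else 0) with hp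
  intro M
  induction M with
  | zero =>
    intro N hN _
    simp
    exact hN _
  | succ M ih =>
    intro N hN hm
    rw [← (Fin.consEquiv (fun _ : Fin (M+1) => Z)).sum_comp, Fintype.sum_prod_type]
    have hprodsum : ∑ Ψ : Fin M → Z, ∏ k, W (Ψ k) = 1 := by
      have := EE_one (T := fun _ : Fin M => Z) (fun _ => W) (fun _ => hW1)
      simpa [EE] using this
    have key : ∀ z, W z * (if mt z then n z else 0) +
        (W z - W z * (if mt z then (1 : ℝ) else 0)) * (T * ∑ k ∈ range M, (1 - p) ^ k)
        ≤ ∑ Ψ : Fin M → Z, (∏ k, W ((Fin.consEquiv (fun _ : Fin (M+1) => Z)) (z, Ψ) k)) *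
          N ((Fin.consEquiv (fun _ : Fin (M+1) => Z)) (z, Ψ)) := by
      intro z
      have e : ∑ Ψ : Fin M → Z, (∏ k, W ((Fin.consEquiv (fun _ : Fin (M+1) => Z)) (z, Ψ) k)) *
          N ((Fin.consEquiv (fun _ : Fin (M+1) => Z)) (z, Ψ)) =
          W z * ∑ Ψ : Fin M → Z, (∏ k, W (Ψ k)) * N (Fin.cons z Ψ) := by
        rw [Finset.mul_sum]
        apply Finset.sum_congr rfl
        intro Ψ _
        simp [Fin.consEquiv, Fin.prod_univ_succ]
        ring
      rw [e]
      by_cases hz : mt z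
      · simp only [hz, if_true, mul_one, sub_self, zero_mul, add_zero]
        apply mul_le_mul_of_nonneg_left _ (hW z)
        calc n z = ∑ Ψ : Fin M → Z, (∏ k, W (Ψ k)) * n z := by
              rw [← Finset.sum_mul, hprodsum, one_mul]
          _ ≤ _ := by
              apply Finset.sum_le_sum
              intro Ψ _
              apply mul_le_mul_of_nonneg_left _ (Finset.prod_nonneg fun k _ => hW _)
              simpa using hm (Fin.cons z Ψ) 0 (by simpa using hz)
      · simp only [hz, if_false, mul_zero, sub_zero, zero_add]
        apply mul_le_mul_of_nonneg_left _ (hW z)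
        apply ih (fun Ψ => N (Fin.cons z Ψ)) (fun Ψ => hN _)
        intro Ψ k hk
        simpa using hm (Fin.cons z Ψ) k.succ (by simpa using hk)
    refine le_trans (le_of_eq ?_) (Finset.sum_le_sum fun z _ => key z)
    rw [Finset.sum_add_distrib, ← Finset.sum_mul, Finset.sum_sub_distrib, hW1, ← hT, ← hp,
      Finset.sum_range_succ', ]
    simp only [pow_succ, pow_zero, ← Finset.sum_mul]
    ring

end RL

namespace RL

section abs
variable {X Y : Type} [Fintype X] [Fintype Y]

lemma box_bound (u : X → ℝ) (v : Y → ℝ) (hu : ∀ x, 0 ≤ u x) (hv : ∀ y, 0 ≤ v y)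
    (s : X → ℝ) (t : Y → ℝ) (hs : ∀ x, s x = 0 ∨ s x = 1) (ht : ∀ y, t y = 0 ∨ t y = 1)
    (B : X → Y → ℝ) (hBs : ∀ x y, s x = 0 → B x y = 0) (hBt : ∀ x y, t y = 0 → B x y = 0)
    (f : X → ℝ) (g : Y → ℝ) (hf : ∀ x, |f x| ≤ 1) (hg : ∀ y, |g y| ≤ 1)
    (γ μ ν : ℝ) (hγ : 0 ≤ γ) (hμ : μ = ∑ x, u x * s x) (hν : ν = ∑ y, v y * t y)
    (hS : γ * μ * ν ≤ ∑ x, ∑ y, u x * v y * (B x y * (f x * g y))) :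
    γ ^ 4 * μ ^ 2 * ν ^ 2 ≤
      ∑ x', ∑ y', u x' * v y' * (B x' y' * ∑ x, ∑ y, u x * v y * (B x y * (B x y' * B x' y))) := by
  have hμ0 : 0 ≤ μ := by
    rw [hμ]; apply Finset.sum_nonneg; intro x _
    rcases hs x with h | h <;> simp [h, hu x]
  have hν0 : 0 ≤ ν := by
    rw [hν]; apply Finset.sum_nonneg; intro x _
    rcases ht x with h | h <;> simp [h, hv x]
  set a : Y → ℝ := fun y => ∑ x, u x * B x y * f x with ha
  have ha0 : ∀ y, t y = 0 → a y = 0 := by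
    intro y hy
    simp only [ha]
    apply Finset.sum_eq_zero
    intro x _
    rw [hBt x y hy]; ring
  have e1 : ∑ x, ∑ y, u x * v y * (B x y * (f x * g y)) = ∑ y, v y * (g y * a y) := by
    rw [Finset.sum_comm]
    apply Finset.sum_congr rfl; intro y _
    simp only [ha, Finset.mul_sum]
    apply Finset.sum_congr rfl; intro x _
    ring
  have s1 : γ ^ 2 * μ ^ 2 * ν ≤ ∑ y, v y * a y ^ 2 := by
    have : 2 * (γ * μ) * ∑ y, v y * (g y * a y) ≤ ∑ y, v y * a y ^ 2 + (γ * μ) ^ 2 * ν := by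
      rw [hν, Finset.mul_sum, Finset.mul_sum, ← Finset.sum_add_distrib]
      apply Finset.sum_le_sum
      intro y _
      rcases ht y with h | h
      · rw [ha0 y h, h]; simp
      · rw [h]
        have hg2 : (g y) ^ 2 ≤ 1 := by
          have := abs_le.1 (hg y); nlinarith
        have : 2 * (γ * μ) * (g y * a y) ≤ a y ^ 2 + (γ * μ) ^ 2 := by
          nlinarith [sq_nonneg (a y - γ * μ * g y), sq_nonneg (γ * μ)]
        nlinarith [hv y, mul_le_mul_of_nonneg_left this (hv y)]
    rw [e1] at hS
    nlinarith [mul_le_mul_of_nonneg_left hS (mul_nonneg hγ hμ0)]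
  set K : X → X → ℝ := fun x x' => ∑ y, v y * (B x y * B x' y) with hK
  have e2 : ∑ y, v y * a y ^ 2 = ∑ x, ∑ x', u x * u x' * (f x * f x' * K x x') := by
    simp only [hK, Finset.mul_sum]
    have : ∀ y, v y * a y ^ 2 = ∑ x, ∑ x', u x * u x' * (f x * f x' * (v y * (B x y * B x' y))) := by
      intro y
      simp only [ha, sq]
      rw [Finset.sum_mul_sum, Finset.mul_sum]
      apply Finset.sum_congr rfl; intro x _
      rw [Finset.mul_sum]
      apply Finset.sum_congr rfl; intro x' _
      ring
    simp only [this]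
    rw [Finset.sum_comm]
    apply Finset.sum_congr rfl; intro x _
    rw [Finset.sum_comm]
  have s2 : γ ^ 4 * μ ^ 2 * ν ^ 2 ≤ ∑ x, ∑ x', u x * u x' * K x x' ^ 2 := by
    have hμ2 : μ ^ 2 = ∑ x, ∑ x', u x * u x' * (s x * s x') := by
      rw [hμ, sq, Finset.sum_mul_sum]
      apply Finset.sum_congr rfl; intro x _
      apply Finset.sum_congr rfl; intro x' _
      ring
    have : 2 * (γ ^ 2 * ν) * ∑ x, ∑ x', u x * u x' * (f x * f x' * K x x') ≤
        ∑ x, ∑ x', u x * u x' * K x x' ^ 2 + (γ ^ 2 * ν) ^ 2 * μ ^ 2 := by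
      rw [hμ2]
      simp only [Finset.mul_sum, ← Finset.sum_add_distrib]
      apply Finset.sum_le_sum; intro x _
      apply Finset.sum_le_sum; intro x' _
      have hx : s x = 0 → K x x' = 0 := by
        intro h; simp only [hK]; apply Finset.sum_eq_zero; intro y _; rw [hBs x y h]; ring
      have hx' : s x' = 0 → K x x' = 0 := by
        intro h; simp only [hK]; apply Finset.sum_eq_zero; intro y _; rw [hBs x' y h]; ring
      rcases hs x with h | h
      · rw [hx h, h]; simp
      rcases hs x' with h' | h'
      · rw [hx' h', h']; simp
      rw [h, h']
      have hf2 : (f x * f x') ^ 2 ≤ 1 := by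
        rw [mul_pow]
        have h1 := abs_le.1 (hf x)
        have h2 := abs_le.1 (hf x')
        have h1 : f x ^ 2 ≤ 1 := by nlinarith
        have h2 : f x' ^ 2 ≤ 1 := by nlinarith
        nlinarith [sq_nonneg (f x), sq_nonneg (f x')]
      have : 2 * (γ ^ 2 * ν) * (f x * f x' * K x x') ≤ K x x' ^ 2 + (γ ^ 2 * ν) ^ 2 := by
        nlinarith [sq_nonneg (K x x' - γ ^ 2 * ν * (f x * f x')), sq_nonneg (γ ^ 2 * ν)]
      have := mul_le_mul_of_nonneg_left this (mul_nonneg (hu x) (hu x'))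
      nlinarith
    rw [e2] at s1
    have h3 := mul_le_mul_of_nonneg_left s1 (mul_nonneg (sq_nonneg γ) hν0)
    nlinarith
  refine s2.trans (le_of_eq ?_)
  rw [Finset.sum_comm]
  apply Finset.sum_congr rfl; intro x' _
  have : ∀ x, u x * u x' * K x x' ^ 2 = ∑ y, ∑ y', u x * u x' *
      ((v y * (B x y * B x' y)) * (v y' * (B x y' * B x' y'))) := by
    intro x
    simp only [hK, sq]
    rw [Finset.sum_mul_sum, Finset.mul_sum]
    apply Finset.sum_congr rfl; intro y _
    rw [Finset.mul_sum]
  simp only [this, Finset.mul_sum]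
  symm
  rw [Finset.sum_comm]
  apply Finset.sum_congr rfl; intro x _
  rw [Finset.sum_comm]
  apply Finset.sum_congr rfl; intro y _
  apply Finset.sum_congr rfl; intro y' _
  ring

variable {α β : Type}

/-- Mass of a color class. -/
noncomputable def mass (u : X → ℝ) (p : X → α) (a : α) : ℝ :=
  ∑ x, if p x = a then u x else 0

/-- Density of `A` on a cell. -/
noncomputable def den (u : X → ℝ) (v : Y → ℝ) (A : X → Y → Prop) (p : X → α) (q : Y → β)
    (a : α) (b : β) : ℝ :=
  (∑ x, ∑ y, if A x y ∧ p x = a ∧ q y = b then u x * v y else 0) /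
  (∑ x, ∑ y, if p x = a ∧ q y = b then u x * v y else 0)

/-- Indicator. -/
noncomputable def ind (P : Prop) : ℝ := if P then 1 else 0

lemma ind_01 (P : Prop) : ind P = 0 ∨ ind P = 1 := by unfold ind; split_ifs <;> simp

lemma ind_true {P : Prop} (h : P) : ind P = 1 := if_pos h
lemma ind_false {P : Prop} (h : ¬ P) : ind P = 0 := if_neg h
lemma ind_nonneg (P : Prop) : 0 ≤ ind P := by unfold ind; split_ifs <;> simp
lemma ind_le_one (P : Prop) : ind P ≤ 1 := by unfold ind; split_ifs <;> simp
lemma ind_and (P Q : Prop) : ind (P ∧ Q) = ind P * ind Q := by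
  unfold ind; by_cases P <;> by_cases Q <;> simp [*]

lemma mass_eq (u : X → ℝ) (p : X → α) (a : α) : mass u p a = ∑ x, u x * ind (p x = a) := by
  simp [mass, ind]

lemma mass_nonneg (u : X → ℝ) (hu : ∀ x, 0 ≤ u x) (p : X → α) (a : α) : 0 ≤ mass u p a := by
  unfold mass; apply Finset.sum_nonneg; intro x _; split_ifs <;> simp [hu x]

lemma cellmass (u : X → ℝ) (v : Y → ℝ) (p : X → α) (q : Y → β) (a : α) (b : β) :
    (∑ x, ∑ y, if p x = a ∧ q y = b then u x * v y else 0) = mass u p a * mass v q b := by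
  simp only [mass, Finset.sum_mul_sum]
  apply Finset.sum_congr rfl; intro x _
  apply Finset.sum_congr rfl; intro y _
  by_cases h1 : p x = a <;> by_cases h2 : q y = b <;> simp [h1, h2]

lemma sum_mass [Fintype α] (u : X → ℝ) (p : X → α) : ∑ a, mass u p a = ∑ x, u x := by
  simp only [mass]
  rw [Finset.sum_comm]
  simp

lemma den_num (u : X → ℝ) (v : Y → ℝ) (hu : ∀ x, 0 ≤ u x) (hv : ∀ y, 0 ≤ v y)
    (A : X → Y → Prop) (p : X → α) (q : Y → β) (a : α) (b : β) :
    (∑ x, ∑ y, if A x y ∧ p x = a ∧ q y = b then u x * v y else 0) =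
      den u v A p q a b * (mass u p a * mass v q b) := by
  rw [← cellmass]
  unfold den
  by_cases h : (∑ x, ∑ y, if p x = a ∧ q y = b then u x * v y else 0) = 0
  · rw [h, mul_zero]
    apply le_antisymm
    · refine le_trans ?_ h.le
      apply Finset.sum_le_sum; intro x _
      apply Finset.sum_le_sum; intro y _
      have := mul_nonneg (hu x) (hv y)
      by_cases h1 : A x y <;> by_cases h2 : p x = a ∧ q y = b <;> simp [h1, h2, this]
    · apply Finset.sum_nonneg; intro x _
      apply Finset.sum_nonneg; intro y _
      have := mul_nonneg (hu x) (hv y)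
      split_ifs <;> simp [this]
  · rw [div_mul_cancel₀ _ h]

lemma den_nonneg (u : X → ℝ) (v : Y → ℝ) (hu : ∀ x, 0 ≤ u x) (hv : ∀ y, 0 ≤ v y)
    (A : X → Y → Prop) (p : X → α) (q : Y → β) (a : α) (b : β) : 0 ≤ den u v A p q a b := by
  unfold den
  apply div_nonneg <;>
  · apply Finset.sum_nonneg; intro x _
    apply Finset.sum_nonneg; intro y _
    have := mul_nonneg (hu x) (hv y)
    split_ifs <;> simp [this]

lemma den_le_one (u : X → ℝ) (v : Y → ℝ) (hu : ∀ x, 0 ≤ u x) (hv : ∀ y, 0 ≤ v y)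
    (A : X → Y → Prop) (p : X → α) (q : Y → β) (a : α) (b : β) : den u v A p q a b ≤ 1 := by
  unfold den
  apply div_le_one_of_le₀
  · apply Finset.sum_le_sum; intro x _
    apply Finset.sum_le_sum; intro y _
    have := mul_nonneg (hu x) (hv y)
    by_cases h1 : A x y <;> by_cases h2 : p x = a ∧ q y = b <;> simp [h1, h2, this]
  · apply Finset.sum_nonneg; intro x _
    apply Finset.sum_nonneg; intro y _
    have := mul_nonneg (hu x) (hv y)
    split_ifs <;> simp [this]

lemma sum_cells [Fintype α] [Fintype β] (p : X → α) (q : Y → β) (F : X → Y → ℝ) :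
    ∑ x, ∑ y, F x y = ∑ a, ∑ b, ∑ x, ∑ y, if p x = a ∧ q y = b then F x y else 0 := by
  have : ∀ x y, F x y = ∑ a, ∑ b, if p x = a ∧ q y = b then F x y else 0 := by
    intro x y
    simp [ite_and]
  calc ∑ x, ∑ y, F x y = ∑ x, ∑ y, ∑ a, ∑ b, (if p x = a ∧ q y = b then F x y else 0) := by
        apply Finset.sum_congr rfl; intro x _
        apply Finset.sum_congr rfl; intro y _
        exact this x y
    _ = ∑ x, ∑ a, ∑ y, ∑ b, (if p x = a ∧ q y = b then F x y else 0) := by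
        apply Finset.sum_congr rfl; intro x _
        rw [Finset.sum_comm]
    _ = ∑ a, ∑ x, ∑ b, ∑ y, (if p x = a ∧ q y = b then F x y else 0) := by
        rw [Finset.sum_comm]
        apply Finset.sum_congr rfl; intro a _
        apply Finset.sum_congr rfl; intro x _
        rw [Finset.sum_comm]
    _ = _ := by
        apply Finset.sum_congr rfl; intro a _
        rw [Finset.sum_comm]

lemma proj [Fintype α] [Fintype β] (u : X → ℝ) (v : Y → ℝ) (hu : ∀ x, 0 ≤ u x)
    (hv : ∀ y, 0 ≤ v y) (A : X → Y → Prop) (p : X → α) (q : Y → β) (H : X → Y → ℝ)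
    (hH : ∀ x x' y y', p x = p x' → q y = q y' → H x y = H x' y') :
    ∑ x, ∑ y, u x * v y * (ind (A x y) * H x y) =
      ∑ x, ∑ y, u x * v y * (den u v A p q (p x) (q y) * H x y) := by
  rw [sum_cells p q, sum_cells p q (fun x y => u x * v y * (den u v A p q (p x) (q y) * H x y))]
  apply Finset.sum_congr rfl; intro a _
  apply Finset.sum_congr rfl; intro b _
  by_cases hex : ∃ x y, p x = a ∧ q y = b
  · obtain ⟨x0, y0, rfl, rfl⟩ := hex
    have h1 : ∀ x y, (if p x = p x0 ∧ q y = q y0 then u x * v y * (ind (A x y) * H x y) else 0) =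
        (if A x y ∧ p x = p x0 ∧ q y = q y0 then u x * v y else 0) * H x0 y0 := by
      intro x y
      by_cases h2 : p x = p x0 ∧ q y = q y0
      · rw [hH x x0 y y0 h2.1 h2.2]
        by_cases h1 : A x y <;> simp [h1, h2, ind]
      · simp [h2]
    have h2 : ∀ x y, (if p x = p x0 ∧ q y = q y0 then
          u x * v y * (den u v A p q (p x) (q y) * H x y) else 0) =
        (if p x = p x0 ∧ q y = q y0 then u x * v y else 0) *
          (den u v A p q (p x0) (q y0) * H x0 y0) := by
      intro x y
      by_cases h2 : p x = p x0 ∧ q y = q y0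
      · rw [hH x x0 y y0 h2.1 h2.2]
        simp [h2]
      · simp [h2]
    simp only [h1, h2, ← Finset.sum_mul]
    rw [den_num u v hu hv, cellmass]
    ring
  · have hex' : ∀ x y, ¬ (p x = a ∧ q y = b) := fun x y h => hex ⟨x, y, h⟩
    simp [hex']

/-- Energy. -/
noncomputable def energy (u : X → ℝ) (v : Y → ℝ) (A : X → Y → Prop) (p : X → α) (q : Y → β) : ℝ :=
  ∑ x, ∑ y, u x * v y * den u v A p q (p x) (q y) ^ 2

lemma energy_nonneg (u : X → ℝ) (v : Y → ℝ) (hu : ∀ x, 0 ≤ u x) (hv : ∀ y, 0 ≤ v y)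
    (A : X → Y → Prop) (p : X → α) (q : Y → β) : 0 ≤ energy u v A p q := by
  apply Finset.sum_nonneg; intro x _
  apply Finset.sum_nonneg; intro y _
  exact mul_nonneg (mul_nonneg (hu x) (hv y)) (sq_nonneg _)

lemma energy_le_one (u : X → ℝ) (v : Y → ℝ) (hu : ∀ x, 0 ≤ u x) (hv : ∀ y, 0 ≤ v y)
    (hu1 : ∑ x, u x = 1) (hv1 : ∑ y, v y = 1)
    (A : X → Y → Prop) (p : X → α) (q : Y → β) : energy u v A p q ≤ 1 := by
  calc energy u v A p q ≤ ∑ x, ∑ y, u x * v y := by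
        apply Finset.sum_le_sum; intro x _
        apply Finset.sum_le_sum; intro y _
        have h0 := den_nonneg u v hu hv A p q (p x) (q y)
        have h1 := den_le_one u v hu hv A p q (p x) (q y)
        have := mul_nonneg (hu x) (hv y)
        have h2 : den u v A p q (p x) (q y) ^ 2 ≤ 1 := by nlinarith
        nlinarith
    _ = 1 := by rw [← Finset.sum_mul_sum, hu1, hv1, one_mul]

variable {α' β' : Type}

lemma pyth [Fintype α] [Fintype β] [Fintype α'] [Fintype β'] (u : X → ℝ) (v : Y → ℝ)
    (hu : ∀ x, 0 ≤ u x) (hv : ∀ y, 0 ≤ v y) (A : X → Y → Prop) (p : X → α) (q : Y → β)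
    (p' : X → α') (q' : Y → β') (hp : ∀ x x', p' x = p' x' → p x = p x')
    (hq : ∀ x x', q' x = q' x' → q x = q x') :
    ∑ x, ∑ y, u x * v y * (den u v A p' q' (p' x) (q' y) - den u v A p q (p x) (q y)) ^ 2 =
      energy u v A p' q' - energy u v A p q := by
  have h1 := proj u v hu hv A p' q' (fun x y => den u v A p q (p x) (q y))
    (fun x x' y y' h1 h2 => by rw [hp _ _ h1, hq _ _ h2])
  have h2 := proj u v hu hv A p q (fun x y => den u v A p q (p x) (q y))
    (fun x x' y y' h1 h2 => by rw [h1, h2])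
  have : ∑ x, ∑ y, u x * v y * (den u v A p' q' (p' x) (q' y) - den u v A p q (p x) (q y)) ^ 2
    = energy u v A p' q' - 2 * ∑ x, ∑ y, u x * v y *
        (den u v A p' q' (p' x) (q' y) * den u v A p q (p x) (q y)) + energy u v A p q := by
    unfold energy
    simp only [Finset.mul_sum, ← Finset.sum_add_distrib, ← Finset.sum_sub_distrib]
    apply Finset.sum_congr rfl; intro x _
    apply Finset.sum_congr rfl; intro y _
    ring
  rw [this, ← h1, h2]
  have : ∑ x, ∑ y, u x * v y * (den u v A p q (p x) (q y) * den u v A p q (p x) (q y)) =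
      energy u v A p q := by
    unfold energy; simp only [sq]
  rw [this]; ring

/-- Balanced function of a cell. -/
noncomputable def BB (u : X → ℝ) (v : Y → ℝ) (A : X → Y → Prop) (p : X → α) (q : Y → β)
    (a : α) (b : β) (x : X) (y : Y) : ℝ :=
  ind (p x = a) * ind (q y = b) * (ind (A x y) - den u v A p q a b)

/-- Cut regularity of a cell. -/
def CutReg (u : X → ℝ) (v : Y → ℝ) (A : X → Y → Prop) (p : X → α) (q : Y → β)
    (γ : ℝ) (a : α) (b : β) : Prop :=
  ∀ (f : X → ℝ) (g : Y → ℝ), (∀ x, |f x| ≤ 1) → (∀ y, |g y| ≤ 1) →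
    |∑ x, ∑ y, u x * v y * (BB u v A p q a b x y * (f x * g y))| ≤ γ * mass u p a * mass v q b

/-- Inner sum for the witness. -/
noncomputable def inner3 (u : X → ℝ) (v : Y → ℝ) (B : X → Y → ℝ) (x' : X) (y' : Y) : ℝ :=
  ∑ x, ∑ y, u x * v y * (B x y * (B x y' * B x' y))

lemma BB_abs (u : X → ℝ) (v : Y → ℝ) (hu : ∀ x, 0 ≤ u x) (hv : ∀ y, 0 ≤ v y)
    (A : X → Y → Prop) (p : X → α) (q : Y → β)
    (a : α) (b : β) (x : X) (y : Y) : |BB u v A p q a b x y| ≤ 1 := by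
  have h0 := den_nonneg u v hu hv A p q a b
  have h1 := den_le_one u v hu hv A p q a b
  unfold BB
  rcases ind_01 (p x = a) with h | h <;> rcases ind_01 (q y = b) with h' | h' <;>
  rcases ind_01 (A x y) with h'' | h'' <;> rw [h, h', h''] <;> rw [abs_le] <;>
  constructor <;> linarith

lemma irreg_box (u : X → ℝ) (v : Y → ℝ) (hu : ∀ x, 0 ≤ u x) (hv : ∀ y, 0 ≤ v y)
    (A : X → Y → Prop) (p : X → α) (q : Y → β) (γ : ℝ) (hγ : 0 ≤ γ) (a : α) (b : β)
    (hirr : ¬ CutReg u v A p q γ a b) :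
    γ ^ 4 * mass u p a ^ 2 * mass v q b ^ 2 ≤
      ∑ x, ∑ y, u x * v y * (if p x = a ∧ q y = b then
        |inner3 u v (BB u v A p q a b) x y| else 0) := by
  unfold CutReg at hirr
  push Not at hirr
  obtain ⟨f, g, hf, hg, hlt⟩ := hirr
  have main : ∀ f : X → ℝ, (∀ x, |f x| ≤ 1) → γ * mass u p a * mass v q b ≤
      ∑ x, ∑ y, u x * v y * (BB u v A p q a b x y * (f x * g y)) →
      γ ^ 4 * mass u p a ^ 2 * mass v q b ^ 2 ≤
      ∑ x, ∑ y, u x * v y * (if p x = a ∧ q y = b then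
        |inner3 u v (BB u v A p q a b) x y| else 0) := by
    intro f hf hle
    have := box_bound u v hu hv (fun x => ind (p x = a)) (fun y => ind (q y = b))
      (fun _ => ind_01 _) (fun _ => ind_01 _) (BB u v A p q a b)
      (fun x y h => by simp [BB, h]) (fun x y h => by simp [BB, h])
      f g hf hg γ _ _ hγ
      (mass_eq u p a) (mass_eq v q b) hle
    refine this.trans ?_
    apply Finset.sum_le_sum; intro x _
    apply Finset.sum_le_sum; intro y _
    apply mul_le_mul_of_nonneg_left _ (mul_nonneg (hu x) (hv y))
    split_ifs with h
    · have h1 := BB_abs u v hu hv A p q a b x y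
      change BB u v A p q a b x y * inner3 u v (BB u v A p q a b) x y ≤ _
      refine (le_abs_self _).trans ?_
      rw [abs_mul]
      nlinarith [abs_nonneg (inner3 u v (BB u v A p q a b) x y)]
    · have : BB u v A p q a b x y = 0 := by
        unfold BB; rw [← ind_and, ind_false h]; ring
      rw [this]; simp
  rcases le_abs.1 hlt.le with h | h
  · exact main f hf h
  · apply main (fun x => - f x) (fun x => by rw [abs_neg]; exact hf x)
    refine h.trans (le_of_eq ?_)
    simp [Finset.sum_neg_distrib]

/-- Local increment in a cell. -/
noncomputable def ninc (u : X → ℝ) (v : Y → ℝ) (A : X → Y → Prop) (p : X → α) (q : Y → β)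
    (p' : X → α') (q' : Y → β') (a : α) (b : β) : ℝ :=
  ∑ x, ∑ y, if p x = a ∧ q y = b then
    u x * v y * (den u v A p' q' (p' x) (q' y) - den u v A p q (p x) (q y)) ^ 2 else 0

lemma ninc_nonneg (u : X → ℝ) (v : Y → ℝ) (hu : ∀ x, 0 ≤ u x) (hv : ∀ y, 0 ≤ v y)
    (A : X → Y → Prop) (p : X → α) (q : Y → β)
    (p' : X → α') (q' : Y → β') (a : α) (b : β) : 0 ≤ ninc u v A p q p' q' a b := by
  unfold ninc
  apply Finset.sum_nonneg; intro x _
  apply Finset.sum_nonneg; intro y _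
  split_ifs
  · exact mul_nonneg (mul_nonneg (hu x) (hv y)) (sq_nonneg _)
  · exact le_rfl

lemma sum_ninc [Fintype α] [Fintype β] [Fintype α'] [Fintype β'] (u : X → ℝ) (v : Y → ℝ)
    (hu : ∀ x, 0 ≤ u x) (hv : ∀ y, 0 ≤ v y) (A : X → Y → Prop) (p : X → α) (q : Y → β)
    (p' : X → α') (q' : Y → β') (hp : ∀ x x', p' x = p' x' → p x = p x')
    (hq : ∀ x x', q' x = q' x' → q x = q x') :
    ∑ a, ∑ b, ninc u v A p q p' q' a b = energy u v A p' q' - energy u v A p q := by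
  rw [← pyth u v hu hv A p q p' q' hp hq]
  unfold ninc
  rw [← sum_cells p q]

lemma inner_le_ninc [Fintype α'] [Fintype β'] (u : X → ℝ) (v : Y → ℝ)
    (hu : ∀ x, 0 ≤ u x) (hv : ∀ y, 0 ≤ v y) (A : X → Y → Prop) (p : X → α) (q : Y → β)
    (p' : X → α') (q' : Y → β') (hp : ∀ x x', p' x = p' x' → p x = p x')
    (hq : ∀ x x', q' x = q' x' → q x = q x') (a : α) (b : β) (x0 : X) (y0 : Y)
    (hx0 : ∀ y y', q' y = q' y' → (A x0 y ↔ A x0 y'))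
    (hy0 : ∀ x x', p' x = p' x' → (A x y0 ↔ A x' y0)) (t : ℝ) (ht : 0 ≤ t) :
    2 * t * |inner3 u v (BB u v A p q a b) x0 y0| - t ^ 2 * (mass u p a * mass v q b) ≤
      ninc u v A p q p' q' a b := by
  set B := BB u v A p q a b with hB
  set d := den u v A p q a b with hd
  have hBx : ∀ x x', p' x = p' x' → B x y0 = B x' y0 := by
    intro x x' h
    simp only [hB, BB, hp x x' h, hy0 x x' h]
  have hBy : ∀ y y', q' y = q' y' → B x0 y = B x0 y' := by
    intro y y' h
    simp only [hB, BB, hq y y' h, hx0 y y' h]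
  have e1 : inner3 u v B x0 y0 = ∑ x, ∑ y, u x * v y * ((den u v A p' q' (p' x) (q' y) - d) *
      (ind (p x = a) * ind (q y = b) * (B x y0 * B x0 y))) := by
    have h1 := proj u v hu hv A p' q'
      (fun x y => ind (p x = a) * ind (q y = b) * (B x y0 * B x0 y))
      (fun x x' y y' h1 h2 => by rw [hp _ _ h1, hq _ _ h2, hBx _ _ h1, hBy _ _ h2])
    have h2 : ∑ x, ∑ y, u x * v y * ((den u v A p' q' (p' x) (q' y) - d) *
      (ind (p x = a) * ind (q y = b) * (B x y0 * B x0 y))) =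
      ∑ x, ∑ y, u x * v y * (den u v A p' q' (p' x) (q' y) *
        (ind (p x = a) * ind (q y = b) * (B x y0 * B x0 y))) -
      ∑ x, ∑ y, u x * v y * (d *
        (ind (p x = a) * ind (q y = b) * (B x y0 * B x0 y))) := by
      simp only [← Finset.sum_sub_distrib]
      apply Finset.sum_congr rfl; intro x _
      apply Finset.sum_congr rfl; intro y _
      ring
    rw [h2, ← h1]
    simp only [← Finset.sum_sub_distrib, inner3]
    apply Finset.sum_congr rfl; intro x _
    apply Finset.sum_congr rfl; intro y _
    have : B x y = ind (p x = a) * ind (q y = b) * (ind (A x y) - d) := rfl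
    rw [this]
    ring
  have e2 : 2 * t * |inner3 u v B x0 y0| ≤
      ∑ x, ∑ y, if p x = a ∧ q y = b then
        u x * v y * ((den u v A p' q' (p' x) (q' y) - den u v A p q (p x) (q y)) ^ 2 + t ^ 2)
        else 0 := by
    rw [e1]
    have : |∑ x, ∑ y, u x * v y * ((den u v A p' q' (p' x) (q' y) - d) *
      (ind (p x = a) * ind (q y = b) * (B x y0 * B x0 y)))| ≤ ∑ x, ∑ y, u x * v y *
        (if p x = a ∧ q y = b then |den u v A p' q' (p' x) (q' y) - d| else 0) := by
      refine (Finset.abs_sum_le_sum_abs _ _).trans ?_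
      apply Finset.sum_le_sum; intro x _
      refine (Finset.abs_sum_le_sum_abs _ _).trans ?_
      apply Finset.sum_le_sum; intro y _
      rw [abs_mul, abs_of_nonneg (mul_nonneg (hu x) (hv y))]
      apply mul_le_mul_of_nonneg_left _ (mul_nonneg (hu x) (hv y))
      rw [← ind_and]
      split_ifs with h
      · rw [ind_true h, one_mul, abs_mul, abs_mul]
        have h1 := BB_abs u v hu hv A p q a b x y0
        have h2 := BB_abs u v hu hv A p q a b x0 y
        have h3 : |B x y0| * |B x0 y| ≤ 1 :=
          mul_le_one₀ h1 (abs_nonneg _) h2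
        nlinarith [abs_nonneg (den u v A p' q' (p' x) (q' y) - d)]
      · rw [ind_false h]; simp
    refine (mul_le_mul_of_nonneg_left this (by linarith : 0 ≤ 2 * t)).trans ?_
    simp only [Finset.mul_sum]
    apply Finset.sum_le_sum; intro x _
    apply Finset.sum_le_sum; intro y _
    split_ifs with h
    · rw [h.1, h.2, ← hd]
      have h1 := mul_nonneg (hu x) (hv y)
      have h2 : 2 * t * |den u v A p' q' (p' x) (q' y) - d| ≤
          (den u v A p' q' (p' x) (q' y) - d) ^ 2 + t ^ 2 := by
        rw [← sq_abs (den u v A p' q' (p' x) (q' y) - d)]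
        nlinarith [sq_nonneg (|den u v A p' q' (p' x) (q' y) - d| - t)]
      have := mul_le_mul_of_nonneg_left h2 h1
      linarith
    · simp
  have e3 : (∑ x, ∑ y, if p x = a ∧ q y = b then
        u x * v y * ((den u v A p' q' (p' x) (q' y) - den u v A p q (p x) (q y)) ^ 2 + t ^ 2)
        else 0) = ninc u v A p q p' q' a b + t ^ 2 * (mass u p a * mass v q b) := by
    rw [← cellmass]
    simp only [ninc, Finset.mul_sum, ← Finset.sum_add_distrib]
    apply Finset.sum_congr rfl; intro x _
    apply Finset.sum_congr rfl; intro y _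
    split_ifs <;> ring
  linarith

end abs

lemma geom_half (p : ℝ) (hp0 : 0 < p) (hp1 : p ≤ 1) (M : ℕ) (hM : 1 ≤ M * p) :
    1 / 2 ≤ p * ∑ k ∈ range M, (1 - p) ^ k := by
  have h1 : p * ∑ k ∈ range M, (1 - p) ^ k = 1 - (1 - p) ^ M := by
    have := mul_neg_geom_sum (1 - p) M
    rw [← this]; ring
  rw [h1]
  have h2 : (1 - p) ^ M * (1 + M * p) ≤ 1 := by
    have hb : 1 + (M : ℝ) * p ≤ (1 + p) ^ M := one_add_mul_le_pow (by linarith) M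
    calc (1 - p) ^ M * (1 + M * p) ≤ (1 - p) ^ M * (1 + p) ^ M :=
          mul_le_mul_of_nonneg_left hb (pow_nonneg (by linarith) _)
      _ = (1 - p ^ 2) ^ M := by rw [← mul_pow]; ring
      _ ≤ 1 := pow_le_one₀ (by nlinarith) (by nlinarith [sq_nonneg p])
  have h3 : 0 ≤ (1 - p) ^ M := pow_nonneg (by linarith) _
  nlinarith

end RL

namespace RL

section sampling
variable {r : ℕ} (Ω : Fin r → Type) [∀ i, Fintype (Ω i)] (w : ∀ i, Ω i → ℝ)

lemma EPhi_flat (h : ℕ) (F : PMap Ω h → ℝ) :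
    EPhi Ω w h F = EE (ι := Fin r × Fin h) (T := fun k => Ω k.1) (fun k : Fin r × Fin h => w k.1)
      (fun ψ => F (fun i a => ψ (i, a))) := by
  unfold EPhi EE pmapWeight
  let e : PMap Ω h ≃ (∀ k : Fin r × Fin h, Ω k.1) :=
    { toFun := fun φ k => φ k.1 k.2
      invFun := fun ψ i a => ψ (i, a)
      left_inv := fun φ => rfl
      right_inv := fun ψ => rfl }
  refine Fintype.sum_equiv e _ _ ?_
  intro φ
  rw [Fintype.prod_prod_type]
  rfl

lemma EPhi_transp (M : ℕ) (F : PMap Ω M → ℝ) :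
    EPhi Ω w M F = ∑ Ψ : Fin M → (∀ i, Ω i), (∏ k, ∏ i, w i (Ψ k i)) *
      F (fun i k => Ψ k i) := by
  unfold EPhi pmapWeight
  let e : PMap Ω M ≃ (Fin M → (∀ i, Ω i)) :=
    { toFun := fun φ k i => φ i k
      invFun := fun ψ i a => ψ a i
      left_inv := fun φ => rfl
      right_inv := fun ψ => rfl }
  refine Fintype.sum_equiv e _ _ ?_
  intro φ
  rw [Finset.prod_comm]
  rfl

/-- Concatenation of samples. -/
def app {m M : ℕ} (φ : PMap Ω m) (Ψ : PMap Ω M) : PMap Ω (m + M) :=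
  fun i => Fin.append (φ i) (Ψ i)

lemma EPhi_append (m M : ℕ) (F : PMap Ω (m + M) → ℝ) :
    EPhi Ω w (m + M) F = EPhi Ω w m (fun φ => EPhi Ω w M (fun Ψ => F (app Ω φ Ψ))) := by
  unfold EPhi pmapWeight
  simp only [Finset.mul_sum]
  rw [← Fintype.sum_prod_type']
  let e : PMap Ω m × PMap Ω M ≃ PMap Ω (m + M) :=
    { toFun := fun z => app Ω z.1 z.2
      invFun := fun ψ => (fun i a => ψ i (Fin.castAdd M a), fun i a => ψ i (Fin.natAdd m a))
      left_inv := fun z => by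
        ext <;> simp [app]
      right_inv := fun ψ => by
        funext i a
        refine Fin.addCases (fun a => ?_) (fun a => ?_) a <;> simp [app] }
  symm
  refine Fintype.sum_equiv e _ _ ?_
  intro z
  simp only [e, Equiv.coe_fn_mk, Fin.prod_univ_add, app, Fin.append_left, Fin.append_right,
    Finset.prod_mul_distrib]
  ring

lemma EPhi_mono (hw : ∀ i x, 0 ≤ w i x)
    (h : ℕ) {F G : PMap Ω h → ℝ} (hFG : ∀ φ, F φ ≤ G φ) :
    EPhi Ω w h F ≤ EPhi Ω w h G := by
  rw [EPhi_flat, EPhi_flat]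
  exact EE_mono _ (fun (k : Fin r × Fin h) x => hw k.1 x) (fun φ => hFG _)

lemma EPhi_const (hw1 : ∀ i, ∑ x : Ω i, w i x = 1)
    (h : ℕ) (c : ℝ) : EPhi Ω w h (fun _ => c) = c := by
  rw [EPhi_flat]
  exact EE_const _ (fun k : Fin r × Fin h => hw1 k.1) c

lemma EPhi_add (h : ℕ) (F G : PMap Ω h → ℝ) :
    EPhi Ω w h (fun φ => F φ + G φ) = EPhi Ω w h F + EPhi Ω w h G := by
  simp [EPhi, mul_add, Finset.sum_add_distrib]

lemma EPhi_sub (h : ℕ) (F G : PMap Ω h → ℝ) :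
    EPhi Ω w h (fun φ => F φ - G φ) = EPhi Ω w h F - EPhi Ω w h G := by
  simp [EPhi, mul_sub, Finset.sum_sub_distrib]

lemma EPhi_cmul (h : ℕ) (F : PMap Ω h → ℝ) (c : ℝ) :
    EPhi Ω w h (fun φ => c * F φ) = c * EPhi Ω w h F := by
  simp only [EPhi, Finset.mul_sum]
  apply Finset.sum_congr rfl; intro φ _
  ring

lemma EPhi_sum {κ : Type} (s : Finset κ) (h : ℕ) (F : κ → PMap Ω h → ℝ) :
    EPhi Ω w h (fun φ => ∑ k ∈ s, F k φ) = ∑ k ∈ s, EPhi Ω w h (F k) := by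
  simp only [EPhi, Finset.mul_sum]
  rw [Finset.sum_comm]

variable {K₁ K₂ : Type} [Fintype K₁] [Fintype K₂] (G : CGraph Ω K₁ K₂)

/-- Vertex colors after regularization. -/
noncomputable def pm {m : ℕ} (φ : PMap Ω m) (i : Fin r) :
    Ω i → K₁ × (Fin r → Fin m → Option K₂) := (regz Ω G φ).vCol i

lemma pm_refine {m M : ℕ} (φ : PMap Ω m) (Ψ : PMap Ω M) (i : Fin r) (x x' : Ω i)
    (hx : pm Ω G (app Ω φ Ψ) i x = pm Ω G (app Ω φ Ψ) i x') : pm Ω G φ i x = pm Ω G φ i x' := by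
  simp only [pm, regz, Prod.mk.injEq] at hx ⊢
  refine ⟨hx.1, ?_⟩
  funext j b
  have := congrFun (congrFun hx.2 j) (Fin.castAdd M b)
  simpa [app] using this

lemma pm_new {m M : ℕ} (φ : PMap Ω m) (Ψ : PMap Ω M) (i j : Fin r) (hij : i ≠ j) (k : Fin M)
    (x x' : Ω i)
    (hx : pm Ω G (app Ω φ Ψ) i x = pm Ω G (app Ω φ Ψ) i x') :
    G.eCol i j x (Ψ j k) = G.eCol i j x' (Ψ j k) := by
  simp only [pm, regz, Prod.mk.injEq] at hx
  have := congrFun (congrFun hx.2 j) (Fin.natAdd m k)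
  simpa [app, hij.symm] using this

lemma cell_inc_abs (hw : ∀ i x, 0 ≤ w i x) (hw1 : ∀ i, ∑ x : Ω i, w i x = 1)
    {α β' α' β'' : Type} [Fintype α'] [Fintype β''] (i j : Fin r) (hij : i ≠ j)
    (A : Ω i → Ω j → Prop) (γ β : ℝ)
    (hγ : 0 ≤ γ) (hβ : 0 < β) (M : ℕ) (hM : 1 ≤ M * β ^ 2) (p : Ω i → α) (q : Ω j → β')
    (p' : PMap Ω M → Ω i → α') (q' : PMap Ω M → Ω j → β'')
    (hp : ∀ Ψ x x', p' Ψ x = p' Ψ x' → p x = p x')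
    (hq : ∀ Ψ x x', q' Ψ x = q' Ψ x' → q x = q x')
    (hp' : ∀ Ψ x x' k, p' Ψ x = p' Ψ x' → (A x (Ψ j k) ↔ A x' (Ψ j k)))
    (hq' : ∀ Ψ y y' k, q' Ψ y = q' Ψ y' → (A (Ψ i k) y ↔ A (Ψ i k) y'))
    (a : α) (b : β')
    (hirr : ¬ CutReg (w i) (w j) A p q γ a b)
    (ha : β ≤ mass (w i) p a) (hb : β ≤ mass (w j) q b) :
    γ ^ 8 / 2 * (mass (w i) p a * mass (w j) q b) ≤
      EPhi Ω w M (fun Ψ => ninc (w i) (w j) A p q (p' Ψ) (q' Ψ) a b) := by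
  have hbox := irreg_box (w i) (w j) (hw i) (hw j) _ _ _ γ hγ a b hirr
  set μ := mass (w i) p a with hμ
  set ν := mass (w j) q b with hν
  set I : Ω i → Ω j → ℝ := fun x y =>
    |inner3 (w i) (w j) (BB (w i) (w j) A p q a b) x y| with hI
  have hμ1 : μ ≤ 1 := by
    rw [← hw1 i, hμ]; unfold mass
    apply Finset.sum_le_sum; intro x _
    split_ifs
    · exact le_rfl
    · exact hw i x
  have hν1 : ν ≤ 1 := by
    rw [← hw1 j, hν]; unfold mass
    apply Finset.sum_le_sum; intro x _
    split_ifs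
    · exact le_rfl
    · exact hw j x
  have hμ0 : 0 < μ := lt_of_lt_of_le hβ ha
  have hν0 : 0 < ν := lt_of_lt_of_le hβ hb
  have hfm := first_match (Z := ∀ i, Ω i) (fun z => ∏ i, w i (z i))
    (fun z => Finset.prod_nonneg fun i _ => hw i _)
    (by have := EE_one w hw1
        simpa [EE] using this)
    (fun z => p (z i) = a ∧ q (z j) = b)
    (fun z => 2 * γ ^ 4 * I (z i) (z j) - (γ ^ 4) ^ 2 * (μ * ν))
    M (fun Ψ => ninc (w i) (w j) A p q
      (p' (fun i k => Ψ k i)) (q' (fun i k => Ψ k i)) a b)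
    (fun Ψ => ninc_nonneg _ _ (hw i) (hw j) _ _ _ _ _ _ _)
    (by
      intro Ψ k hk
      apply inner_le_ninc (w i) (w j) (hw i) (hw j)
      · exact hp _
      · exact hq _
      · intro y y' h; exact hq' (fun i k => Ψ k i) y y' k h
      · intro x x' h; exact hp' (fun i k => Ψ k i) x x' k h
      · positivity)
  rw [EPhi_transp]
  refine le_trans ?_ hfm
  have hpp : ∑ z : (∀ i, Ω i), (∏ i, w i (z i)) *
      (if p (z i) = a ∧ q (z j) = b then (1 : ℝ) else 0) = μ * ν := by
    have := EE_marginal2 w hw1 i j hij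
      (fun x y => if p x = a ∧ q y = b then (1 : ℝ) else 0)
    unfold EE at this
    rw [this, hμ, hν, ← cellmass]
    simp
  have hT : ∑ z : (∀ i, Ω i), (∏ i, w i (z i)) *
      (if p (z i) = a ∧ q (z j) = b then
        2 * γ ^ 4 * I (z i) (z j) - (γ ^ 4) ^ 2 * (μ * ν) else 0) =
      2 * γ ^ 4 * (∑ x, ∑ y, w i x * w j y *
        (if p x = a ∧ q y = b then I x y else 0)) -
        (γ ^ 4) ^ 2 * (μ * ν) * (μ * ν) := by
    have := EE_marginal2 w hw1 i j hij
      (fun x y => if p x = a ∧ q y = b then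
        2 * γ ^ 4 * I x y - (γ ^ 4) ^ 2 * (μ * ν) else 0)
    unfold EE at this
    rw [this]
    have hc := cellmass (w i) (w j) p q a b
    rw [← hμ, ← hν] at hc
    have h2 : (γ ^ 4) ^ 2 * (μ * ν) * (μ * ν) = (γ ^ 4) ^ 2 * (μ * ν) *
        (∑ x, ∑ y, if p x = a ∧ q y = b then w i x * w j y else 0) := by rw [hc]
    rw [h2]
    clear_value μ ν
    simp only [Finset.mul_sum, ← Finset.sum_sub_distrib]
    apply Finset.sum_congr rfl; intro x _
    apply Finset.sum_congr rfl; intro y _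
    split_ifs <;> ring
  rw [hT, hpp]
  have hg := geom_half (μ * ν) (mul_pos hμ0 hν0) (mul_le_one₀ hμ1 hν0.le hν1) M (by
    refine hM.trans ?_
    apply mul_le_mul_of_nonneg_left _ (Nat.cast_nonneg M)
    rw [sq]; exact mul_le_mul ha hb hβ.le hμ0.le)
  set g := ∑ k ∈ range M, (1 - μ * ν) ^ k
  have hg0 : 0 ≤ g := by
    apply Finset.sum_nonneg; intro k _
    apply pow_nonneg
    have := mul_le_one₀ hμ1 hν0.le hν1
    linarith
  have hTT : γ ^ 8 * (μ * ν) ^ 2 ≤ 2 * γ ^ 4 * (∑ x, ∑ y, w i x * w j y *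
        (if p x = a ∧ q y = b then I x y else 0)) -
        (γ ^ 4) ^ 2 * (μ * ν) * (μ * ν) := by
    have := mul_le_mul_of_nonneg_left hbox (by positivity : 0 ≤ 2 * γ ^ 4)
    nlinarith
  calc γ ^ 8 / 2 * (μ * ν) = γ ^ 8 * (μ * ν) * (1 / 2) := by ring
    _ ≤ γ ^ 8 * (μ * ν) * (μ * ν * g) := mul_le_mul_of_nonneg_left hg (by positivity)
    _ = γ ^ 8 * (μ * ν) ^ 2 * g := by ring
    _ ≤ _ := mul_le_mul_of_nonneg_right hTT hg0

lemma cell_inc (hw : ∀ i x, 0 ≤ w i x) (hw1 : ∀ i, ∑ x : Ω i, w i x = 1)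
    {m : ℕ} (φ : PMap Ω m) (i j : Fin r) (hij : i ≠ j) (c : K₂) (γ β : ℝ)
    (hγ : 0 ≤ γ) (hβ : 0 < β) (M : ℕ) (hM : 1 ≤ M * β ^ 2)
    (a b : K₁ × (Fin r → Fin m → Option K₂))
    (hirr : ¬ CutReg (w i) (w j) (fun x y => G.eCol i j x y = c) (pm Ω G φ i) (pm Ω G φ j) γ a b)
    (ha : β ≤ mass (w i) (pm Ω G φ i) a) (hb : β ≤ mass (w j) (pm Ω G φ j) b) :
    γ ^ 8 / 2 * (mass (w i) (pm Ω G φ i) a * mass (w j) (pm Ω G φ j) b) ≤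
      EPhi Ω w M (fun Ψ => ninc (w i) (w j) (fun x y => G.eCol i j x y = c)
        (pm Ω G φ i) (pm Ω G φ j) (pm Ω G (app Ω φ Ψ) i) (pm Ω G (app Ω φ Ψ) j) a b) := by
  refine cell_inc_abs Ω w hw hw1 i j hij _ γ β hγ hβ M hM _ _
    (fun Ψ => pm Ω G (app Ω φ Ψ) i) (fun Ψ => pm Ω G (app Ω φ Ψ) j) ?_ ?_ ?_ ?_ a b hirr ha hb
  · intro Ψ x x' h; exact pm_refine Ω G _ _ _ _ _ h
  · intro Ψ x x' h; exact pm_refine Ω G _ _ _ _ _ h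
  · intro Ψ x x' k h
    have := pm_new Ω G φ Ψ i j hij k x x' h
    rw [this]
  · intro Ψ y y' k h
    have := pm_new Ω G φ Ψ j i hij.symm k y y' h
    rw [G.eSymm i j _ y, G.eSymm i j _ y', this]

end sampling
end RL

namespace RL

section counting
variable {r h : ℕ} (Ω : Fin r → Type) [∀ i, Fintype (Ω i)] (w : ∀ i, Ω i → ℝ)
  {K₁ K₂ : Type} (G : CGraph Ω K₁ K₂) (S : SComplex r h K₁ K₂)

/-- Vertex indicator. -/
noncomputable def vI (p : Fin r × Fin h) (x : Ω p.1) : ℝ :=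
  ind (some (G.vCol p.1 x) = S.vCol p.1 p.2)

/-- Edge indicator. -/
noncomputable def eI (q : Fin r × Fin r × Fin h × Fin h) (ψ : ∀ k : Fin r × Fin h, Ω k.1) : ℝ :=
  ind (some (G.eCol q.1 q.2.1 (ψ (q.1, q.2.2.1)) (ψ (q.2.1, q.2.2.2))) =
    S.eCol q.1 q.2.1 q.2.2.1 q.2.2.2)

/-- Counting with a restricted set of edges. -/
noncomputable def cnt (D : Finset (Fin r × Fin r × Fin h × Fin h)) : ℝ :=
  EE (fun k : Fin r × Fin h => w k.1)
    (fun ψ => (∏ p ∈ V1 S, vI Ω G S p (ψ p)) * ∏ q ∈ D, eI Ω G S q ψ)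

lemma prod_ind {κ : Type} (s : Finset κ) (P : κ → Prop) :
    ∏ k ∈ s, ind (P k) = ind (∀ k ∈ s, P k) := by
  induction s using Finset.induction_on with
  | empty => simp [ind]
  | insert a s ha ih =>
    rw [Finset.prod_insert ha, ih, ← ind_and]
    congr 1
    simp

lemma countProb_eq : countProb Ω w G S = cnt Ω w G S (V2 S) := by
  unfold countProb cnt
  rw [EPhi_flat]
  congr 1
  funext ψ
  unfold vI eI
  rw [prod_ind, prod_ind, ← ind_and]
  unfold ind vEvent eEvent
  congr


lemma cnt_anti (hw : ∀ i x, 0 ≤ w i x)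
    {D D' : Finset (Fin r × Fin r × Fin h × Fin h)} (hD : D ⊆ D') :
    cnt Ω w G S D' ≤ cnt Ω w G S D := by
  unfold cnt
  apply EE_mono _ (fun (k : Fin r × Fin h) x => hw k.1 x)
  intro ψ
  apply mul_le_mul_of_nonneg_left _ (Finset.prod_nonneg fun p _ => ind_nonneg _)
  exact Finset.prod_le_prod_of_subset_of_le_one hD (fun q _ => ind_nonneg _) (fun q _ _ => ind_le_one _)

lemma cnt_nonneg (hw : ∀ i x, 0 ≤ w i x)
    (D : Finset (Fin r × Fin r × Fin h × Fin h)) : 0 ≤ cnt Ω w G S D := by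
  unfold cnt EE
  apply Finset.sum_nonneg
  intro ψ _
  apply mul_nonneg (Finset.prod_nonneg fun k _ => hw _ _)
  exact mul_nonneg (Finset.prod_nonneg fun p _ => ind_nonneg _)
    (Finset.prod_nonneg fun p _ => ind_nonneg _)

lemma dVS_eq (p : Fin r × Fin h) (hp : p ∈ V1 S) :
    ∑ x, w p.1 x * vI Ω G S p x = dVS Ω w G S p := by
  simp only [V1, mem_filter, mem_univ, true_and] at hp
  obtain ⟨c, hc⟩ := Option.ne_none_iff_exists'.1 hp
  unfold dVS vI
  rw [hc]
  simp [dV, ind]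

lemma dVS_nonneg (hw : ∀ i x, 0 ≤ w i x) (p : Fin r × Fin h) : 0 ≤ dVS Ω w G S p := by
  unfold dVS
  split
  · unfold dV
    apply Finset.sum_nonneg; intro x _; split_ifs <;> simp [hw]
  · simp

lemma EE_vert (hw1 : ∀ i, ∑ x : Ω i, w i x = 1)
    (P : Finset (Fin r × Fin h)) (hP : P ⊆ V1 S) :
    EE (fun k : Fin r × Fin h => w k.1) (fun ψ => ∏ p ∈ P, vI Ω G S p (ψ p)) =
      ∏ p ∈ P, dVS Ω w G S p := by
  have h1 := EE_prod (fun k : Fin r × Fin h => w k.1)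
    (fun k x => if k ∈ P then vI Ω G S k x else 1)
  have h2 : ∀ ψ : (∀ k : Fin r × Fin h, Ω k.1), ∏ k, (if k ∈ P then vI Ω G S k (ψ k) else 1) =
      ∏ p ∈ P, vI Ω G S p (ψ p) := by
    intro ψ
    rw [Finset.prod_ite_mem, Finset.univ_inter]
  simp only [h2] at h1
  rw [h1, ← Finset.univ_inter P, ← Finset.prod_ite_mem, Finset.univ_inter]
  apply Finset.prod_congr rfl
  intro k _
  by_cases hk : k ∈ P
  · simp only [hk, if_true]
    exact dVS_eq Ω w G S k (hP hk)
  · simp [hk, hw1]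

/-- A good edge. -/
def GoodE (γ : ℝ) (q : Fin r × Fin r × Fin h × Fin h) : Prop :=
  ∀ c ci cj, S.eCol q.1 q.2.1 q.2.2.1 q.2.2.2 = some c → S.vCol q.1 q.2.2.1 = some ci →
    S.vCol q.2.1 q.2.2.2 = some cj →
    CutReg (w q.1) (w q.2.1) (fun x y => G.eCol q.1 q.2.1 x y = c) (G.vCol q.1) (G.vCol q.2.1)
      γ ci cj

lemma V2_spec (q : Fin r × Fin r × Fin h × Fin h) (hq : q ∈ V2 S) :
    q.1 < q.2.1 ∧ ∃ c ci cj, S.eCol q.1 q.2.1 q.2.2.1 q.2.2.2 = some c ∧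
      S.vCol q.1 q.2.2.1 = some ci ∧ S.vCol q.2.1 q.2.2.2 = some cj := by
  simp only [V2, mem_filter, mem_univ, true_and] at hq
  obtain ⟨hlt, hne⟩ := hq
  refine ⟨hlt, ?_⟩
  obtain ⟨c, hc⟩ := Option.ne_none_iff_exists'.1 hne
  have h1 : S.vCol q.1 q.2.2.1 ≠ none := fun h0 => hne (S.down _ _ _ _ h0)
  have h2 : S.vCol q.2.1 q.2.2.2 ≠ none := fun h0 => hne (by rw [S.eSymm]; exact S.down _ _ _ _ h0)
  obtain ⟨ci, hci⟩ := Option.ne_none_iff_exists'.1 h1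
  obtain ⟨cj, hcj⟩ := Option.ne_none_iff_exists'.1 h2
  exact ⟨c, ci, cj, hc, hci, hcj⟩

lemma dES_eq (q : Fin r × Fin r × Fin h × Fin h) (c : K₂) (ci cj : K₁)
    (hc : S.eCol q.1 q.2.1 q.2.2.1 q.2.2.2 = some c)
    (hci : S.vCol q.1 q.2.2.1 = some ci) (hcj : S.vCol q.2.1 q.2.2.2 = some cj) :
    dES Ω w G S q = den (w q.1) (w q.2.1) (fun x y => G.eCol q.1 q.2.1 x y = c)
      (G.vCol q.1) (G.vCol q.2.1) ci cj := by
  unfold dES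
  rw [hc, hci, hcj]
  rfl

lemma split_prod (q0 : Fin r × Fin r × Fin h × Fin h) (hq0 : q0.1 < q0.2.1)
    (D : Finset (Fin r × Fin r × Fin h × Fin h)) (hD : ∀ q ∈ D, q.1 < q.2.1 ∧ q ≠ q0)
    (ψ : ∀ k : Fin r × Fin h, Ω k.1) :
    ∃ (f : Ω q0.1 → ℝ) (g : Ω q0.2.1 → ℝ), (∀ x, |f x| ≤ 1) ∧ (∀ y, |g y| ≤ 1) ∧
      ∀ x y, ∏ q ∈ D, eI Ω G S q (Function.update (Function.update ψ (q0.1, q0.2.2.1) x)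
        (q0.2.1, q0.2.2.2) y) = f x * g y := by
  induction D using Finset.induction_on with
  | empty => exact ⟨fun _ => 1, fun _ => 1, by simp, by simp, by simp⟩
  | insert q D hqD ih =>
    obtain ⟨f, g, hf, hg, hfg⟩ := ih (fun q hq => hD q (Finset.mem_insert_of_mem hq))
    obtain ⟨hlt, hne⟩ := hD q (Finset.mem_insert_self _ _)
    have habs : ∀ ψ, |eI Ω G S q ψ| ≤ 1 := by
      intro ψ; unfold eI; rw [abs_of_nonneg (ind_nonneg _)]; exact ind_le_one _
    have hcases : ((q.1, q.2.2.1) ≠ (q0.2.1, q0.2.2.2) ∧ (q.2.1, q.2.2.2) ≠ (q0.2.1, q0.2.2.2)) ∨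
        ((q.1, q.2.2.1) ≠ (q0.1, q0.2.2.1) ∧ (q.2.1, q.2.2.2) ≠ (q0.1, q0.2.2.1)) := by
      obtain ⟨i, j, a, b⟩ := q
      obtain ⟨i0, j0, a0, b0⟩ := q0
      simp only [ne_eq, Prod.mk.injEq] at *
      by_contra hcon
      push Not at hcon
      obtain ⟨h1, h2⟩ := hcon
      by_cases e1 : i = j0 ∧ a = b0
      · by_cases e2 : i = i0 ∧ a = a0
        · omega
        · have h3 := h2 (fun hi ha => e2 ⟨hi, ha⟩)
          omega
      · have h3 := h1 (fun hi ha => e1 ⟨hi, ha⟩)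
        by_cases e2 : i = i0 ∧ a = a0
        · exact hne ⟨e2.1, h3.1, e2.2, h3.2⟩
        · have h4 := h2 (fun hi ha => e2 ⟨hi, ha⟩)
          omega
    rcases hcases with ⟨h1, h2⟩ | ⟨h1, h2⟩
    · refine ⟨fun x => eI Ω G S q (Function.update ψ (q0.1, q0.2.2.1) x) * f x, g, ?_, hg, ?_⟩
      · intro x
        rw [abs_mul]
        exact mul_le_one₀ (habs _) (abs_nonneg _) (hf x)
      · intro x y
        rw [Finset.prod_insert hqD, hfg]
        have : eI Ω G S q (Function.update (Function.update ψ (q0.1, q0.2.2.1) x)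
            (q0.2.1, q0.2.2.2) y) = eI Ω G S q (Function.update ψ (q0.1, q0.2.2.1) x) := by
          unfold eI
          rw [Function.update_of_ne h1, Function.update_of_ne h2]
        rw [this]; ring
    · refine ⟨f, fun y => eI Ω G S q (Function.update ψ (q0.2.1, q0.2.2.2) y) * g y, hf, ?_, ?_⟩
      · intro x
        rw [abs_mul]
        exact mul_le_one₀ (habs _) (abs_nonneg _) (hg x)
      · intro x y
        rw [Finset.prod_insert hqD, hfg]
        have : eI Ω G S q (Function.update (Function.update ψ (q0.1, q0.2.2.1) x)
            (q0.2.1, q0.2.2.2) y) = eI Ω G S q (Function.update ψ (q0.2.1, q0.2.2.2) y) := by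
          rw [Function.update_comm]
          · unfold eI
            rw [Function.update_of_ne h1, Function.update_of_ne h2]
          · intro hh
            simp only [Prod.mk.injEq] at hh
            omega
        rw [this]; ring

lemma step_bound (hw : ∀ i x, 0 ≤ w i x) (hw1 : ∀ i, ∑ x : Ω i, w i x = 1)
    (γ : ℝ) (q0 : Fin r × Fin r × Fin h × Fin h) (hq0 : q0 ∈ V2 S)
    (hgood : GoodE Ω w G S γ q0)
    (D : Finset (Fin r × Fin r × Fin h × Fin h)) (hD : D ⊆ V2 S) (hqD : q0 ∉ D) :
    |EE (fun k : Fin r × Fin h => w k.1)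
      (fun ψ => (∏ p ∈ V1 S, vI Ω G S p (ψ p)) *
        ((eI Ω G S q0 ψ - dES Ω w G S q0) * ∏ q ∈ D, eI Ω G S q ψ))| ≤
      γ * ∏ p ∈ V1 S, dVS Ω w G S p := by
  obtain ⟨hlt, c, ci, cj, hc, hci, hcj⟩ := V2_spec S q0 hq0
  have hreg := hgood c ci cj hc hci hcj
  have hkl : ((q0.1, q0.2.2.1) : Fin r × Fin h) ≠ (q0.2.1, q0.2.2.2) := by
    intro hh
    simp only [Prod.mk.injEq] at hh
    omega
  have hk : ((q0.1, q0.2.2.1) : Fin r × Fin h) ∈ V1 S := by simp [V1, hci]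
  have hl : ((q0.2.1, q0.2.2.2) : Fin r × Fin h) ∈ V1 S := by simp [V1, hcj]
  have hl' : ((q0.2.1, q0.2.2.2) : Fin r × Fin h) ∈ (V1 S).erase (q0.1, q0.2.2.1) :=
    Finset.mem_erase.2 ⟨hkl.symm, hl⟩
  set P := ((V1 S).erase (q0.1, q0.2.2.1)).erase (q0.2.1, q0.2.2.2) with hP
  have hPsub : P ⊆ V1 S := (Finset.erase_subset _ _).trans (Finset.erase_subset _ _)
  have hdk : dVS Ω w G S (q0.1, q0.2.2.1) = mass (w q0.1) (G.vCol q0.1) ci := by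
    unfold dVS; simp only [hci]; rfl
  have hdl : dVS Ω w G S (q0.2.1, q0.2.2.2) = mass (w q0.2.1) (G.vCol q0.2.1) cj := by
    unfold dVS; simp only [hcj]; rfl
  have hV : ∏ p ∈ V1 S, dVS Ω w G S p = mass (w q0.1) (G.vCol q0.1) ci *
      (mass (w q0.2.1) (G.vCol q0.2.1) cj * ∏ p ∈ P, dVS Ω w G S p) := by
    rw [← Finset.mul_prod_erase _ _ hk, ← Finset.mul_prod_erase _ _ hl', hdk, hdl]
  rw [EE_resample2 _ (fun k : Fin r × Fin h => hw1 k.1) (q0.1, q0.2.2.1) (q0.2.1, q0.2.2.2)]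
  have hb : γ * ∏ p ∈ V1 S, dVS Ω w G S p =
      EE (fun k : Fin r × Fin h => w k.1) (fun ψ => (∏ p ∈ P, vI Ω G S p (ψ p)) *
        (γ * mass (w q0.1) (G.vCol q0.1) ci * mass (w q0.2.1) (G.vCol q0.2.1) cj)) := by
    rw [EE_mul_const, EE_vert Ω w G S hw1 P hPsub, hV]
    ring
  rw [hb]
  apply EE_abs_le _ (fun (k : Fin r × Fin h) x => hw k.1 x)
  intro ψ
  obtain ⟨f, g, hf, hg, hfg⟩ := split_prod Ω G S q0 hlt D
    (fun q hq => ⟨(V2_spec S q (hD hq)).1, fun e => hqD (e ▸ hq)⟩) ψ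
  have hR0 : 0 ≤ ∏ p ∈ P, vI Ω G S p (ψ p) := Finset.prod_nonneg fun p _ => ind_nonneg _
  have e1 : ∑ x : Ω q0.1, ∑ y : Ω q0.2.1, w q0.1 x * w q0.2.1 y *
      ((∏ p ∈ V1 S, vI Ω G S p (Function.update (Function.update ψ (q0.1, q0.2.2.1) x)
        (q0.2.1, q0.2.2.2) y p)) *
        ((eI Ω G S q0 (Function.update (Function.update ψ (q0.1, q0.2.2.1) x)
        (q0.2.1, q0.2.2.2) y) - dES Ω w G S q0) *
        ∏ q ∈ D, eI Ω G S q (Function.update (Function.update ψ (q0.1, q0.2.2.1) x)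
        (q0.2.1, q0.2.2.2) y))) = (∏ p ∈ P, vI Ω G S p (ψ p)) *
      ∑ x, ∑ y, w q0.1 x * w q0.2.1 y *
        (BB (w q0.1) (w q0.2.1) (fun x y => G.eCol q0.1 q0.2.1 x y = c) (G.vCol q0.1)
          (G.vCol q0.2.1) ci cj x y * (f x * g y)) := by
    simp only [Finset.mul_sum]
    apply Finset.sum_congr rfl; intro x _
    apply Finset.sum_congr rfl; intro y _
    rw [hfg]
    have hv : ∏ p ∈ V1 S, vI Ω G S p (Function.update (Function.update ψ (q0.1, q0.2.2.1) x)
        (q0.2.1, q0.2.2.2) y p) = ind (G.vCol q0.1 x = ci) * (ind (G.vCol q0.2.1 y = cj) *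
          ∏ p ∈ P, vI Ω G S p (ψ p)) := by
      rw [← Finset.mul_prod_erase _ _ hk, ← Finset.mul_prod_erase _ _ hl']
      congr 1
      · rw [Function.update_of_ne hkl, Function.update_self]
        unfold vI; simp only [hci, Option.some.injEq]
      · congr 1
        · rw [Function.update_self]
          unfold vI; simp only [hcj, Option.some.injEq]
        · apply Finset.prod_congr rfl
          intro p hp
          rw [Function.update_of_ne (Finset.ne_of_mem_erase hp),
            Function.update_of_ne (Finset.ne_of_mem_erase (Finset.mem_of_mem_erase hp))]
    have he : eI Ω G S q0 (Function.update (Function.update ψ (q0.1, q0.2.2.1) x)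
        (q0.2.1, q0.2.2.2) y) = ind (G.eCol q0.1 q0.2.1 x y = c) := by
      unfold eI
      rw [Function.update_self, Function.update_of_ne hkl, Function.update_self, hc]
      simp only [Option.some.injEq]
    rw [hv, he, dES_eq Ω w G S q0 c ci cj hc hci hcj]
    unfold BB
    ring
  simp only
  rw [e1, abs_mul, abs_of_nonneg hR0]
  exact mul_le_mul_of_nonneg_left (hreg f g hf hg) hR0

lemma dES_01 (hw : ∀ i x, 0 ≤ w i x)
    (q : Fin r × Fin r × Fin h × Fin h) (hq : q ∈ V2 S) :
    0 ≤ dES Ω w G S q ∧ dES Ω w G S q ≤ 1 := by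
  obtain ⟨hlt, c, ci, cj, hc, hci, hcj⟩ := V2_spec S q hq
  rw [dES_eq Ω w G S q c ci cj hc hci hcj]
  exact ⟨den_nonneg _ _ (hw _) (hw _) _ _ _ _ _, den_le_one _ _ (hw _) (hw _) _ _ _ _ _⟩

lemma counting (hw : ∀ i x, 0 ≤ w i x) (hw1 : ∀ i, ∑ x : Ω i, w i x = 1)
    (γ : ℝ) (hγ : 0 ≤ γ) (D : Finset (Fin r × Fin r × Fin h × Fin h))
    (hD : D ⊆ V2 S) (hgood : ∀ q ∈ D, GoodE Ω w G S γ q) :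
    |cnt Ω w G S D - (∏ p ∈ V1 S, dVS Ω w G S p) * ∏ q ∈ D, dES Ω w G S q| ≤
      D.card * γ * ∏ p ∈ V1 S, dVS Ω w G S p := by
  set Vp := ∏ p ∈ V1 S, dVS Ω w G S p with hVp
  have hVp0 : 0 ≤ Vp := Finset.prod_nonneg fun p _ => dVS_nonneg Ω w G S hw p
  induction D using Finset.induction_on with
  | empty =>
    have := EE_vert Ω w G S hw1 (V1 S) (le_refl _)
    simp only [cnt, Finset.prod_empty, mul_one, this]
    simp [hVp]
  | insert q0 D hqD ih =>
    have hD' : D ⊆ V2 S := fun q hq => hD (Finset.mem_insert_of_mem hq)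
    have hq0 : q0 ∈ V2 S := hD (Finset.mem_insert_self _ _)
    have ih := ih hD' (fun q hq => hgood q (Finset.mem_insert_of_mem hq))
    have hs := step_bound Ω w G S hw hw1 γ q0 hq0 (hgood q0 (Finset.mem_insert_self _ _)) D hD' hqD
    set R := EE (fun k : Fin r × Fin h => w k.1)
      (fun ψ => (∏ p ∈ V1 S, vI Ω G S p (ψ p)) *
        ((eI Ω G S q0 ψ - dES Ω w G S q0) * ∏ q ∈ D, eI Ω G S q ψ)) with hR
    have e : cnt Ω w G S (insert q0 D) = cnt Ω w G S D * dES Ω w G S q0 + R := by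
      unfold cnt
      rw [hR, ← EE_mul_const, ← EE_add]
      congr 1
      funext ψ
      rw [Finset.prod_insert hqD]
      ring
    rw [e, Finset.prod_insert hqD, Finset.card_insert_of_notMem hqD]
    obtain ⟨hd0, hd1⟩ := dES_01 Ω w G S hw q0 hq0
    have e2 : cnt Ω w G S D * dES Ω w G S q0 + R -
        Vp * (dES Ω w G S q0 * ∏ q ∈ D, dES Ω w G S q) =
        dES Ω w G S q0 * (cnt Ω w G S D - Vp * ∏ q ∈ D, dES Ω w G S q) + R := by ring
    rw [e2]
    refine (abs_add_le _ _).trans ?_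
    rw [abs_mul, abs_of_nonneg hd0]
    push_cast
    have h1 : dES Ω w G S q0 * |cnt Ω w G S D - Vp * ∏ q ∈ D, dES Ω w G S q| ≤
        |cnt Ω w G S D - Vp * ∏ q ∈ D, dES Ω w G S q| :=
      mul_le_of_le_one_left (abs_nonneg _) hd1
    nlinarith

lemma prod_add_ge {κ : Type} (s : Finset κ) (hs : s.Nonempty) (a : κ → ℝ) (b : ℝ)
    (ha : ∀ k ∈ s, 0 ≤ a k) (hb : 0 ≤ b) :
    ∏ k ∈ s, a k + b ^ s.card ≤ ∏ k ∈ s, (a k + b) := by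
  induction hs using Finset.Nonempty.cons_induction with
  | singleton k => simp
  | cons k s hk hs ih =>
    rw [Finset.prod_cons, Finset.prod_cons, Finset.card_cons]
    have ih := ih (fun k hk => ha k (Finset.mem_cons_of_mem hk))
    have hak := ha k (Finset.mem_cons_self _ _)
    have hp : 0 ≤ ∏ k ∈ s, a k := Finset.prod_nonneg fun k hk => ha k (Finset.mem_cons_of_mem hk)
    have hb' : 0 ≤ b ^ s.card := pow_nonneg hb _
    have := mul_le_mul_of_nonneg_left ih (add_nonneg hak hb)
    rw [pow_succ]
    nlinarith [mul_nonneg hak hb', mul_nonneg hb hp]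

/-- The error function. -/
noncomputable def dlt (γ δ0 : ℝ) (i j : Fin r) (c : K₂) (ci cj : K₁) : ℝ :=
  if CutReg (w i) (w j) (fun x y => G.eCol i j x y = c) (G.vCol i) (G.vCol j) γ ci cj
  then δ0 else 1

lemma count_eq (hw : ∀ i x, 0 ≤ w i x) (hw1 : ∀ i, ∑ x : Ω i, w i x = 1)
    (γ δ0 : ℝ) (hγ : 0 ≤ γ) (hδ0 : 0 ≤ δ0)
    (hγδ : ∀ n : ℕ, 1 ≤ n → n ≤ r * (r * (h * h)) → n * γ ≤ δ0 ^ n) :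
    CountEqAt Ω w G (dlt Ω w G γ δ0) S := by
  set Vp := ∏ p ∈ V1 S, dVS Ω w G S p with hVp
  have hVp0 : 0 ≤ Vp := Finset.prod_nonneg fun p _ => dVS_nonneg Ω w G S hw p
  set d := dES Ω w G S with hd
  set δ := deltaS (dlt Ω w G γ δ0) S with hδ
  have hδspec : ∀ q ∈ V2 S, (GoodE Ω w G S γ q ∧ δ q = δ0) ∨ (¬ GoodE Ω w G S γ q ∧ δ q = 1) := by
    intro q hq
    obtain ⟨hlt, c, ci, cj, hc, hci, hcj⟩ := V2_spec S q hq
    have : δ q = dlt Ω w G γ δ0 q.1 q.2.1 c ci cj := by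
      simp only [hδ, deltaS]; rw [hc, hci, hcj]
    rw [this]
    unfold dlt
    by_cases hcr : CutReg (w q.1) (w q.2.1) (fun x y => G.eCol q.1 q.2.1 x y = c)
      (G.vCol q.1) (G.vCol q.2.1) γ ci cj
    · left
      refine ⟨?_, if_pos hcr⟩
      intro c' ci' cj' h1 h2 h3
      rw [hc] at h1; rw [hci] at h2; rw [hcj] at h3
      cases h1; cases h2; cases h3
      exact hcr
    · right
      exact ⟨fun hg => hcr (hg c ci cj hc hci hcj), if_neg hcr⟩
  have hd01 : ∀ q ∈ V2 S, 0 ≤ d q ∧ d q ≤ 1 := fun q hq => dES_01 Ω w G S hw q hq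
  have hδ0' : ∀ q ∈ V2 S, 0 ≤ δ q := by
    intro q hq
    rcases hδspec q hq with ⟨_, h1⟩ | ⟨_, h1⟩ <;> rw [h1]
    · exact hδ0
    · exact zero_le_one
  have hcardle : ∀ D ⊆ V2 S, D.card ≤ r * (r * (h * h)) := by
    intro D _
    refine (Finset.card_le_univ D).trans (le_of_eq ?_)
    simp [Fintype.card_prod]
  set lo : Fin r × Fin r × Fin h × Fin h → ℝ := fun q => max 0 (d q - δ q) with hlo
  set hi : Fin r × Fin r × Fin h × Fin h → ℝ := fun q => min 1 (d q + δ q) with hhi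
  have hlohi : ∀ q ∈ V2 S, lo q ≤ hi q := by
    intro q hq
    have h1 := hd01 q hq
    have h2 := hδ0' q hq
    simp only [hlo, hhi]
    apply max_le <;> apply le_min <;> linarith
  have hlo0 : ∀ q, 0 ≤ lo q := fun q => le_max_left _ _
  -- upper bound
  have hU : cnt Ω w G S (V2 S) ≤ Vp * ∏ q ∈ V2 S, hi q := by
    set D := (V2 S).filter (fun q => GoodE Ω w G S γ q ∧ d q + δ0 < 1) with hD
    have hDV : D ⊆ V2 S := Finset.filter_subset _ _
    have h1 : cnt Ω w G S (V2 S) ≤ cnt Ω w G S D := cnt_anti Ω w G S hw hDV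
    have h2 := counting Ω w G S hw hw1 γ hγ D hDV (fun q hq => (Finset.mem_filter.1 hq).2.1)
    have h3 : ∏ q ∈ V2 S, hi q = ∏ q ∈ D, (d q + δ0) := by
      symm
      have : ∏ q ∈ D, (d q + δ0) = ∏ q ∈ D, hi q := by
        apply Finset.prod_congr rfl
        intro q hq
        have hq' := Finset.mem_filter.1 hq
        rcases hδspec q hq'.1 with ⟨_, h4⟩ | ⟨h4, _⟩
        · simp only [hhi, h4]
          rw [min_eq_right hq'.2.2.le]
        · exact absurd hq'.2.1 h4
      rw [this]
      apply Finset.prod_subset hDV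
      intro q hq hqD
      simp only [hhi]
      apply min_eq_left
      rcases hδspec q hq with ⟨h4, h5⟩ | ⟨h4, h5⟩
      · rw [h5]
        by_contra hcon
        push Not at hcon
        exact hqD (Finset.mem_filter.2 ⟨hq, h4, hcon⟩)
      · rw [h5]; linarith [(hd01 q hq).1]
    rw [h3]
    refine h1.trans ?_
    have h4 := (abs_le.1 h2).2
    have h5 : ∏ q ∈ D, d q + D.card * γ ≤ ∏ q ∈ D, (d q + δ0) := by
      rcases D.eq_empty_or_nonempty with h0 | h0
      · rw [h0]; simp
      · have := prod_add_ge D h0 d δ0 (fun q hq => (hd01 q (hDV hq)).1) hδ0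
        have h6 := hγδ D.card (Finset.card_pos.2 h0) (hcardle D hDV)
        linarith
    have h6 := mul_le_mul_of_nonneg_left h5 hVp0
    rw [← hVp, ← hd] at h4
    linarith
  have hL : Vp * ∏ q ∈ V2 S, lo q ≤ cnt Ω w G S (V2 S) := by
    by_cases hz : ∃ q ∈ V2 S, lo q = 0
    · obtain ⟨q, hq, h0⟩ := hz
      rw [Finset.prod_eq_zero hq h0, mul_zero]
      exact cnt_nonneg Ω w G S hw _
    · push Not at hz
      have hpos : ∀ q ∈ V2 S, 0 < d q - δ q := by
        intro q hq
        by_contra hcon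
        push Not at hcon
        exact hz q hq (max_eq_left hcon)
      have hgood : ∀ q ∈ V2 S, GoodE Ω w G S γ q ∧ δ q = δ0 := by
        intro q hq
        rcases hδspec q hq with h4 | ⟨_, h5⟩
        · exact h4
        · have := hpos q hq
          have := (hd01 q hq).2
          linarith
      have h2 := counting Ω w G S hw hw1 γ hγ (V2 S) (le_refl _) (fun q hq => (hgood q hq).1)
      have h3 : ∏ q ∈ V2 S, lo q = ∏ q ∈ V2 S, (d q - δ0) := by
        apply Finset.prod_congr rfl
        intro q hq
        simp only [hlo]
        rw [max_eq_right (hpos q hq).le, (hgood q hq).2]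
      rw [h3]
      have h5 : ∏ q ∈ V2 S, (d q - δ0) + (V2 S).card * γ ≤ ∏ q ∈ V2 S, d q := by
        rcases (V2 S).eq_empty_or_nonempty with h0 | h0
        · rw [h0]; simp
        · have := prod_add_ge (V2 S) h0 (fun q => d q - δ0) δ0
            (fun q hq => by have := hpos q hq; rw [(hgood q hq).2] at this; exact this.le) hδ0
          simp only [sub_add_cancel] at this
          have h6 := hγδ (V2 S).card (Finset.card_pos.2 h0) (hcardle _ (le_refl _))
          linarith
      have h6 := mul_le_mul_of_nonneg_left h5 hVp0
      have h4 := (abs_le.1 h2).1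
      rw [← hVp, ← hd] at h4
      linarith
  -- intermediate value
  let F : ℝ → ℝ := fun t => Vp * ∏ q ∈ V2 S, (lo q + t * (hi q - lo q))
  have hcont : ContinuousOn F (Set.Icc 0 1) := by
    apply Continuous.continuousOn
    simp only [F]
    fun_prop
  have hivt := intermediate_value_Icc (zero_le_one' ℝ) hcont
  have hmem : cnt Ω w G S (V2 S) ∈ Set.Icc (F 0) (F 1) := by
    constructor
    · simpa [F] using hL
    · simpa [F] using hU
  obtain ⟨t, ht, hFt⟩ := hivt hmem
  refine ⟨fun q => lo q + t * (hi q - lo q), ?_, ?_⟩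
  · intro q hq
    have h1 := hlohi q hq
    constructor
    · change lo q ≤ _
      nlinarith [ht.1, ht.2]
    · change _ ≤ hi q
      nlinarith [ht.1, ht.2]
  · rw [countProb_eq, ← hFt]

end counting
end RL

namespace RL
section final

lemma sum_mass_mul {X α : Type} [Fintype X] [Fintype α] (u : X → ℝ) (p : X → α) (f : α → ℝ) :
    ∑ a, mass u p a * f a = ∑ x, u x * f (p x) := by
  simp only [mass_eq, Finset.sum_mul]
  rw [Finset.sum_comm]
  apply Finset.sum_congr rfl
  intro x _
  rw [Finset.sum_eq_single (p x)]
  · rw [ind_true rfl, mul_one]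
  · intro a _ ha
    rw [ind_false (fun h => ha h.symm)]; ring
  · intro h; exact absurd (mem_univ _) h

lemma bp_cells {X Y α β K : Type} [Fintype X] [Fintype Y] [Fintype α] [Fintype β]
    (u : X → ℝ) (v : Y → ℝ) (hu : ∀ x, 0 ≤ u x) (hv : ∀ y, 0 ≤ v y)
    (p : X → α) (q : Y → β) (col : X → Y → K) (C : Finset K) (hC : ∀ x y, col x y ∈ C)
    (N : K → α → β → Prop) :
    ∑ x, ∑ y, u x * v y * ind (N (col x y) (p x) (q y)) ≤
      ∑ c ∈ C, ∑ a, ∑ b, ind (N c a b) * (mass u p a * mass v q b) := by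
  have key : ∀ c, ∑ a, ∑ b, ind (N c a b) * (mass u p a * mass v q b)
      = ∑ x, ∑ y, u x * v y * ind (N c (p x) (q y)) := by
    intro c
    have h1 : ∀ a, ∑ b, ind (N c a b) * (mass u p a * mass v q b)
        = mass u p a * ∑ y, v y * ind (N c a (q y)) := by
      intro a
      rw [← sum_mass_mul v q (fun b => ind (N c a b)), Finset.mul_sum]
      apply Finset.sum_congr rfl
      intro b _; ring
    simp only [h1]
    rw [sum_mass_mul u p (fun a => ∑ y, v y * ind (N c a (q y)))]
    apply Finset.sum_congr rfl
    intro x _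
    rw [Finset.mul_sum]
    apply Finset.sum_congr rfl
    intro y _; ring
  simp only [key]
  rw [Finset.sum_comm (s := C)]
  apply Finset.sum_le_sum
  intro x _
  rw [Finset.sum_comm (s := C)]
  apply Finset.sum_le_sum
  intro y _
  exact Finset.single_le_sum (f := fun c => u x * v y * ind (N c (p x) (q y)))
    (fun c _ => mul_nonneg (mul_nonneg (hu x) (hv y)) (ind_nonneg _)) (hC x y)

lemma small_mass {X α : Type} [Fintype X] [Fintype α] (u : X → ℝ) (hu : ∀ x, 0 ≤ u x)
    (p : X → α) (CA : Finset α) (hp : ∀ x, p x ∈ CA) (β R : ℝ) (hβ : 0 ≤ β)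
    (hR : (CA.card : ℝ) ≤ R) :
    ∑ a, ind (mass u p a < β) * mass u p a ≤ β * R := by
  have h0 : ∑ a, ind (mass u p a < β) * mass u p a
      = ∑ a ∈ CA, ind (mass u p a < β) * mass u p a := by
    symm
    apply Finset.sum_subset (Finset.subset_univ _)
    intro a _ ha
    have : mass u p a = 0 := by
      rw [mass_eq]
      apply Finset.sum_eq_zero
      intro x _
      rw [ind_false (fun h : p x = a => ha (h ▸ hp x)), mul_zero]
    rw [this, mul_zero]
  rw [h0]
  calc ∑ a ∈ CA, ind (mass u p a < β) * mass u p a ≤ ∑ a ∈ CA, β := by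
        apply Finset.sum_le_sum
        intro a _
        by_cases h : mass u p a < β
        · rw [ind_true h]; linarith
        · rw [ind_false h]; linarith
    _ = CA.card * β := by simp
    _ ≤ β * R := by nlinarith

lemma cells_bound {X Y α β : Type} [Fintype X] [Fintype Y] [Fintype α] [Fintype β]
    (u : X → ℝ) (v : Y → ℝ) (hu : ∀ x, 0 ≤ u x) (hv : ∀ y, 0 ≤ v y)
    (hu1 : ∑ x, u x = 1) (hv1 : ∑ y, v y = 1)
    (p : X → α) (q : Y → β) (CA : Finset α) (CB : Finset β)
    (hp : ∀ x, p x ∈ CA) (hq : ∀ y, q y ∈ CB) (t R : ℝ) (ht : 0 ≤ t)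
    (hA : (CA.card : ℝ) ≤ R) (hB : (CB.card : ℝ) ≤ R)
    (N : α → β → Prop) (T : α → β → ℝ) (g : ℝ) (hg : 0 < g) (hT0 : ∀ a b, 0 ≤ T a b)
    (hT : ∀ a b, N a b → t ≤ mass u p a → t ≤ mass v q b →
      g / 2 * (mass u p a * mass v q b) ≤ T a b) :
    ∑ a, ∑ b, ind (N a b) * (mass u p a * mass v q b) ≤
      2 * (t * R) + 2 / g * ∑ a, ∑ b, T a b := by
  have h1 := small_mass u hu p CA hp t R ht hA
  have h2 := small_mass v hv q CB hq t R ht hB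
  have e1 : ∑ a, ∑ b, ind (mass u p a < t) * mass u p a * mass v q b
      = ∑ a, ind (mass u p a < t) * mass u p a := by
    apply Finset.sum_congr rfl
    intro a _
    rw [← Finset.mul_sum, sum_mass, hv1, mul_one]
  have e2 : ∑ a, ∑ b, mass u p a * (ind (mass v q b < t) * mass v q b)
      = ∑ b, ind (mass v q b < t) * mass v q b := by
    simp only [← Finset.mul_sum]
    rw [← Finset.sum_mul, sum_mass, hu1, one_mul]
  have h3 : ∑ a, ∑ b, ind (N a b) * (mass u p a * mass v q b) ≤
      ∑ a, ∑ b, (ind (mass u p a < t) * mass u p a * mass v q b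
        + mass u p a * (ind (mass v q b < t) * mass v q b) + 2 / g * T a b) := by
    apply Finset.sum_le_sum
    intro a _
    apply Finset.sum_le_sum
    intro b _
    have ma := mass_nonneg u hu p a
    have mb := mass_nonneg v hv q b
    have hT0' : 0 ≤ 2 / g * T a b := mul_nonneg (by positivity) (hT0 a b)
    have mab := mul_nonneg ma mb
    have i1 := mul_nonneg (mul_nonneg (ind_nonneg (mass u p a < t)) ma) mb
    have i2 := mul_nonneg ma (mul_nonneg (ind_nonneg (mass v q b < t)) mb)
    by_cases hN : N a b
    · rw [ind_true hN, one_mul]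
      by_cases c1 : mass u p a < t
      · rw [ind_true c1] at i1 ⊢; linarith
      by_cases c2 : mass v q b < t
      · rw [ind_true c2] at i2 ⊢; linarith
      have := hT a b hN (not_lt.1 c1) (not_lt.1 c2)
      have h5 : 2 / g * (g / 2 * (mass u p a * mass v q b)) ≤ 2 / g * T a b :=
        mul_le_mul_of_nonneg_left this (by positivity)
      have h6 : 2 / g * (g / 2 * (mass u p a * mass v q b)) = mass u p a * mass v q b := by
        field_simp
      linarith
    · rw [ind_false hN, zero_mul]; linarith
  simp only [Finset.sum_add_distrib, e1, e2] at h3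
  have e3 : ∑ a, ∑ b, 2 / g * T a b = 2 / g * ∑ a, ∑ b, T a b := by
    simp only [Finset.mul_sum]
  rw [e3] at h3
  linarith

lemma reg_le {r h : ℕ} (hr : 2 ≤ r) (Ω : Fin r → Type) [∀ i, Fintype (Ω i)] [∀ i, Nonempty (Ω i)]
    (w : ∀ i, Ω i → ℝ) (hw : ∀ i x, 0 ≤ w i x) {K₁ K₂ : Type} (G : CGraph Ω K₁ K₂) (e : ℝ)
    (he : IsRegularG Ω w G h e) : reg Ω w G h ≤ e := by
  unfold reg
  refine csInf_le ⟨0, ?_⟩ (show e ∈ {ε : ℝ | IsRegularG Ω w G h ε} from he)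
  rintro e' ⟨δ, hδ, -, h2⟩
  have hij : (⟨0, by omega⟩ : Fin r) ≠ ⟨1, by omega⟩ := by simp
  have h3 := h2 _ _ hij
  set i : Fin r := ⟨0, by omega⟩
  set j : Fin r := ⟨1, by omega⟩
  have hc : 0 < (G.C2 i j).card :=
    Finset.card_pos.2 ⟨_, G.eMem i j (Classical.arbitrary _) (Classical.arbitrary _)⟩
  have h4 : 0 ≤ EdgeDeltaAvg Ω w G δ i j := by
    unfold EdgeDeltaAvg
    exact Finset.sum_nonneg fun x _ => Finset.sum_nonneg fun y _ =>
      mul_nonneg (mul_nonneg (hw _ _) (hw _ _)) (hδ _ _ _ _ _)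
  by_contra hneg
  have : e' / (G.C2 i j).card < 0 := div_neg_of_neg_of_pos (not_le.1 hneg) (by exact_mod_cast hc)
  linarith

noncomputable def bp {r : ℕ} (Ω : Fin r → Type) [∀ i, Fintype (Ω i)]
    (w : ∀ i, Ω i → ℝ) {K₁ K₂ : Type} (G : CGraph Ω K₁ K₂) (γ : ℝ) (i j : Fin r) : ℝ :=
  ∑ x, ∑ y, w i x * w j y * ind (¬ CutReg (w i) (w j) (fun x' y' => G.eCol i j x' y' = G.eCol i j x y)
    (G.vCol i) (G.vCol j) γ (G.vCol i x) (G.vCol j y))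

lemma reg_bound {r h : ℕ} (hr : 2 ≤ r) (Ω : Fin r → Type) [∀ i, Fintype (Ω i)]
    [∀ i, Nonempty (Ω i)]
    (w : ∀ i, Ω i → ℝ) (hw : ∀ i x, 0 ≤ w i x) (hw1 : ∀ i, ∑ x : Ω i, w i x = 1)
    {K₁ K₂ : Type} (G : CGraph Ω K₁ K₂) (b₂ : ℕ)
    (hb : ∀ i j, i ≠ j → (G.C2 i j).card ≤ b₂) (γ δ0 : ℝ) (hγ : 0 ≤ γ) (hδ0 : 0 ≤ δ0)
    (hγδ : ∀ n : ℕ, 1 ≤ n → n ≤ r * (r * (h * h)) → n * γ ≤ δ0 ^ n) :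
    reg Ω w G h ≤ b₂ * (δ0 + ∑ p ∈ (univ : Finset (Fin r)).offDiag, bp Ω w G γ p.1 p.2) := by
  have bp0 : ∀ i j, 0 ≤ bp Ω w G γ i j := fun i j =>
    Finset.sum_nonneg fun x _ => Finset.sum_nonneg fun y _ =>
      mul_nonneg (mul_nonneg (hw _ _) (hw _ _)) (ind_nonneg _)
  apply reg_le hr Ω w hw
  refine ⟨dlt Ω w G γ δ0, ?_, fun S _ => count_eq Ω w G S hw hw1 γ δ0 hγ hδ0 hγδ, ?_⟩
  · intro i j c ci cj
    unfold dlt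
    split_ifs <;> linarith
  · intro i j hij
    have h1 : EdgeDeltaAvg Ω w G (dlt Ω w G γ δ0) i j ≤ δ0 + bp Ω w G γ i j := by
      have hs : δ0 = ∑ x, ∑ y, w i x * w j y * δ0 := by
        simp only [← Finset.sum_mul, ← Finset.mul_sum, hw1, one_mul, mul_one]
      refine le_of_le_of_eq ?_ (congrArg (fun t => t + bp Ω w G γ i j) hs.symm)
      unfold EdgeDeltaAvg bp
      rw [← Finset.sum_add_distrib]
      apply Finset.sum_le_sum
      intro x _
      rw [← Finset.sum_add_distrib]
      apply Finset.sum_le_sum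
      intro y _
      rw [← mul_add]
      apply mul_le_mul_of_nonneg_left _ (mul_nonneg (hw _ _) (hw _ _))
      unfold dlt
      split_ifs with hc
      · have := ind_nonneg (¬ CutReg (w i) (w j) (fun x' y' => G.eCol i j x' y' = G.eCol i j x y)
          (G.vCol i) (G.vCol j) γ (G.vCol i x) (G.vCol j y))
        linarith
      · rw [ind_true hc]; linarith
    have hc : 0 < (G.C2 i j).card :=
      Finset.card_pos.2 ⟨_, G.eMem i j (Classical.arbitrary _) (Classical.arbitrary _)⟩
    have h2 : bp Ω w G γ i j ≤ ∑ p ∈ (univ : Finset (Fin r)).offDiag, bp Ω w G γ p.1 p.2 :=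
      Finset.single_le_sum (f := fun p : Fin r × Fin r => bp Ω w G γ p.1 p.2)
        (fun p _ => bp0 p.1 p.2) (a := (i, j)) (by simp [hij])
    have h3 : ((G.C2 i j).card : ℝ) ≤ b₂ := by exact_mod_cast hb i j hij
    have hc' : (0 : ℝ) < (G.C2 i j).card := by exact_mod_cast hc
    rw [le_div_iff₀ hc']
    have h4 : 0 ≤ δ0 + bp Ω w G γ i j := add_nonneg hδ0 (bp0 i j)
    calc EdgeDeltaAvg Ω w G (dlt Ω w G γ δ0) i j * (G.C2 i j).card
        ≤ (δ0 + bp Ω w G γ i j) * (G.C2 i j).card := by gcongr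
      _ ≤ (δ0 + bp Ω w G γ i j) * b₂ := by gcongr
      _ ≤ (δ0 + ∑ p ∈ (univ : Finset (Fin r)).offDiag, bp Ω w G γ p.1 p.2) * b₂ := by gcongr
      _ = _ := by ring

lemma card_C1 {r : ℕ} (Ω : Fin r → Type) [∀ i, Fintype (Ω i)]
    {K₁ K₂ : Type} [Fintype K₁] [Fintype K₂] (G : CGraph Ω K₁ K₂) {m : ℕ} (φ : PMap Ω m)
    (b₁ b₂ : ℕ) (hb₂ : 1 ≤ b₂) (hG : G.Bounded b₁ b₂) (i : Fin r) :
    ((regz Ω G φ).C1 i).card ≤ b₁ * b₂ ^ (r * m) := by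
  have hsub : (regz Ω G φ).C1 i ⊆ G.C1 i ×ˢ Fintype.piFinset (fun j : Fin r =>
      Fintype.piFinset (fun _ : Fin m =>
        if j = i then ({none} : Finset (Option K₂)) else (G.C2 i j).image some)) := by
    intro p hp
    simp only [regz, mem_filter, mem_univ, true_and] at hp
    rw [Finset.mem_product]
    refine ⟨hp.1, ?_⟩
    rw [Fintype.mem_piFinset]
    intro j
    rw [Fintype.mem_piFinset]
    intro b
    have := hp.2 j b
    by_cases hj : j = i
    · simp only [hj, if_true] at this ⊢
      simpa using this
    · simp only [hj, if_false] at this ⊢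
      obtain ⟨c, hc, h⟩ := this
      rw [h]
      exact Finset.mem_image_of_mem _ hc
  refine (Finset.card_le_card hsub).trans ?_
  rw [Finset.card_product, Fintype.card_piFinset]
  apply Nat.mul_le_mul (hG.1 i)
  have : ∀ j : Fin r, (Fintype.piFinset (fun _ : Fin m =>
        if j = i then ({none} : Finset (Option K₂)) else (G.C2 i j).image some)).card
        ≤ b₂ ^ m := by
    intro j
    rw [Fintype.card_piFinset]
    simp only [Finset.prod_const, Finset.card_univ, Fintype.card_fin]
    apply Nat.pow_le_pow_left
    by_cases hj : j = i
    · simpa [hj] using hb₂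
    · simp only [hj, if_false]
      exact Finset.card_image_le.trans (hG.2 i j (fun h => hj h.symm))
  refine (Finset.prod_le_prod' fun j _ => this j).trans ?_
  simp [← pow_mul, mul_comm]

/-- energy of one color pair -/
noncomputable def en {r : ℕ} (Ω : Fin r → Type) [∀ i, Fintype (Ω i)]
    (w : ∀ i, Ω i → ℝ) {K₁ K₂ : Type} [Fintype K₁] [Fintype K₂] (G : CGraph Ω K₁ K₂) {m : ℕ}
    (φ : PMap Ω m) (i j : Fin r) (c : K₂) : ℝ :=
  energy (w i) (w j) (fun x y => G.eCol i j x y = c) (pm Ω G φ i) (pm Ω G φ j)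

lemma bp_bound {r : ℕ} (Ω : Fin r → Type) [∀ i, Fintype (Ω i)]
    (w : ∀ i, Ω i → ℝ) (hw : ∀ i x, 0 ≤ w i x) (hw1 : ∀ i, ∑ x : Ω i, w i x = 1)
    {K₁ K₂ : Type} [Fintype K₁] [Fintype K₂] (G : CGraph Ω K₁ K₂) {m : ℕ} (φ : PMap Ω m)
    (b₁ b₂ : ℕ) (hb₂ : 1 ≤ b₂) (hG : G.Bounded b₁ b₂) (γ β : ℝ) (hγ : 0 < γ) (hβ : 0 < β)
    (M : ℕ) (hM : 1 ≤ (M : ℝ) * β ^ 2) (i j : Fin r) (hij : i ≠ j) :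
    bp Ω w (regz Ω G φ) γ i j ≤ b₂ * (2 * (β * ((b₁ * b₂ ^ (r * m) : ℕ) : ℝ))) +
      2 / γ ^ 8 * ∑ c ∈ G.C2 i j,
        (EPhi Ω w M (fun Ψ => en Ω w G (app Ω φ Ψ) i j c) - en Ω w G φ i j c) := by
  have h1 := bp_cells (w i) (w j) (hw i) (hw j) (pm Ω G φ i) (pm Ω G φ j) (G.eCol i j) (G.C2 i j)
    (G.eMem i j) (fun c a b => ¬ CutReg (w i) (w j) (fun x' y' => G.eCol i j x' y' = c)
      (pm Ω G φ i) (pm Ω G φ j) γ a b)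
  refine (show bp Ω w (regz Ω G φ) γ i j ≤ _ from h1).trans ?_
  have h2 : ∀ c, ∑ a, ∑ b, ind (¬ CutReg (w i) (w j) (fun x' y' => G.eCol i j x' y' = c)
      (pm Ω G φ i) (pm Ω G φ j) γ a b) * (mass (w i) (pm Ω G φ i) a * mass (w j) (pm Ω G φ j) b)
      ≤ 2 * (β * ((b₁ * b₂ ^ (r * m) : ℕ) : ℝ)) + 2 / γ ^ 8 *
        (EPhi Ω w M (fun Ψ => en Ω w G (app Ω φ Ψ) i j c) - en Ω w G φ i j c) := by
    intro c
    have h3 := cells_bound (w i) (w j) (hw i) (hw j) (hw1 i) (hw1 j) (pm Ω G φ i) (pm Ω G φ j)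
      ((regz Ω G φ).C1 i) ((regz Ω G φ).C1 j) ((regz Ω G φ).vMem i) ((regz Ω G φ).vMem j)
      β ((b₁ * b₂ ^ (r * m) : ℕ) : ℝ) hβ.le
      (by exact_mod_cast card_C1 Ω G φ b₁ b₂ hb₂ hG i)
      (by exact_mod_cast card_C1 Ω G φ b₁ b₂ hb₂ hG j)
      (fun a b => ¬ CutReg (w i) (w j) (fun x' y' => G.eCol i j x' y' = c)
        (pm Ω G φ i) (pm Ω G φ j) γ a b)
      (fun a b => EPhi Ω w M fun Ψ =>
        ninc (w i) (w j) (fun x y => G.eCol i j x y = c) (pm Ω G φ i) (pm Ω G φ j)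
          (pm Ω G (app Ω φ Ψ) i) (pm Ω G (app Ω φ Ψ) j) a b) (γ ^ 8) (by positivity)
      (fun a b => by
        have := EPhi_mono Ω w hw M (F := fun _ => 0) (G := fun Ψ =>
          ninc (w i) (w j) (fun x y => G.eCol i j x y = c) (pm Ω G φ i) (pm Ω G φ j)
          (pm Ω G (app Ω φ Ψ) i) (pm Ω G (app Ω φ Ψ) j) a b)
          (fun Ψ => ninc_nonneg _ _ (hw i) (hw j) _ _ _ _ _ _ _)
        rwa [EPhi_const Ω w hw1] at this)
      (fun a b hN ha hb => cell_inc Ω w G hw hw1 φ i j hij c γ β hγ.le hβ M hM a b hN ha hb)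
    refine h3.trans (le_of_eq ?_)
    congr 2
    have h4 : en Ω w G φ i j c = EPhi Ω w M (fun _ => en Ω w G φ i j c) :=
      (EPhi_const Ω w hw1 M _).symm
    rw [h4, ← EPhi_sub]
    simp only [← EPhi_sum]
    congr 1
    funext Ψ
    exact sum_ninc _ _ (hw i) (hw j) _ _ _ _ _ (pm_refine Ω G φ Ψ i) (pm_refine Ω G φ Ψ j)
  refine (Finset.sum_le_sum fun c _ => h2 c).trans ?_
  rw [Finset.sum_add_distrib, Finset.sum_const, nsmul_eq_mul, ← Finset.mul_sum]
  have : ((G.C2 i j).card : ℝ) ≤ b₂ := by exact_mod_cast hG.2 i j hij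
  gcongr

/-- total expected energy -/
noncomputable def EN {r : ℕ} (Ω : Fin r → Type) [∀ i, Fintype (Ω i)]
    (w : ∀ i, Ω i → ℝ) {K₁ K₂ : Type} [Fintype K₁] [Fintype K₂] (G : CGraph Ω K₁ K₂) (m : ℕ) : ℝ :=
  EPhi Ω w m (fun φ => ∑ p ∈ (univ : Finset (Fin r)).offDiag, ∑ c ∈ G.C2 p.1 p.2,
    en Ω w G φ p.1 p.2 c)

lemma card_offDiag_le (r : ℕ) : (((univ : Finset (Fin r)).offDiag.card : ℕ) : ℝ) ≤ (r : ℝ) ^ 2 := by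
  have : (univ : Finset (Fin r)).offDiag.card ≤ r ^ 2 := by
    refine (Finset.card_le_univ _).trans ?_
    simp [sq]
  exact_mod_cast this

lemma EN_bounds {r : ℕ} (Ω : Fin r → Type) [∀ i, Fintype (Ω i)]
    (w : ∀ i, Ω i → ℝ) (hw : ∀ i x, 0 ≤ w i x) (hw1 : ∀ i, ∑ x : Ω i, w i x = 1)
    {K₁ K₂ : Type} [Fintype K₁] [Fintype K₂] (G : CGraph Ω K₁ K₂)
    (b₁ b₂ : ℕ) (hG : G.Bounded b₁ b₂) (m : ℕ) :
    0 ≤ EN Ω w G m ∧ EN Ω w G m ≤ (r : ℝ) ^ 2 * b₂ := by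
  constructor
  · rw [← EPhi_const Ω w hw1 m 0]
    apply EPhi_mono Ω w hw
    intro φ
    exact Finset.sum_nonneg fun p _ => Finset.sum_nonneg fun c _ =>
      energy_nonneg _ _ (hw _) (hw _) _ _ _
  · rw [← EPhi_const Ω w hw1 m ((r : ℝ) ^ 2 * b₂)]
    apply EPhi_mono Ω w hw
    intro φ
    calc ∑ p ∈ (univ : Finset (Fin r)).offDiag, ∑ c ∈ G.C2 p.1 p.2, en Ω w G φ p.1 p.2 c
        ≤ ∑ p ∈ (univ : Finset (Fin r)).offDiag, (b₂ : ℝ) := by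
          apply Finset.sum_le_sum
          intro p hp
          calc ∑ c ∈ G.C2 p.1 p.2, en Ω w G φ p.1 p.2 c ≤ ∑ c ∈ G.C2 p.1 p.2, (1 : ℝ) :=
                Finset.sum_le_sum fun c _ =>
                  energy_le_one _ _ (hw _) (hw _) (hw1 _) (hw1 _) _ _ _
            _ = (G.C2 p.1 p.2).card := by simp
            _ ≤ b₂ := by exact_mod_cast hG.2 _ _ (by simpa using hp)
      _ = ((univ : Finset (Fin r)).offDiag.card : ℝ) * b₂ := by
          rw [Finset.sum_const, nsmul_eq_mul]
      _ ≤ (r : ℝ) ^ 2 * b₂ := by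
          have := card_offDiag_le r
          gcongr

lemma main_step {r h : ℕ} (hr : 2 ≤ r) (Ω : Fin r → Type) [∀ i, Fintype (Ω i)]
    [∀ i, Nonempty (Ω i)]
    (w : ∀ i, Ω i → ℝ) (hw : ∀ i x, 0 ≤ w i x) (hw1 : ∀ i, ∑ x : Ω i, w i x = 1)
    {K₁ K₂ : Type} [Fintype K₁] [Fintype K₂] (G : CGraph Ω K₁ K₂)
    (b₁ b₂ : ℕ) (hb₂ : 1 ≤ b₂) (hG : G.Bounded b₁ b₂) (γ δ0 β : ℝ) (hγ : 0 < γ) (hδ0 : 0 ≤ δ0)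
    (hβ : 0 < β)
    (hγδ : ∀ n : ℕ, 1 ≤ n → n ≤ r * (r * (h * h)) → n * γ ≤ δ0 ^ n)
    (m M : ℕ) (hM : 1 ≤ (M : ℝ) * β ^ 2) :
    EPhi Ω w m (fun φ => reg Ω w (regz Ω G φ) h) ≤
      b₂ * (δ0 + (r : ℝ) ^ 2 * (b₂ * (2 * (β * ((b₁ * b₂ ^ (r * m) : ℕ) : ℝ)))) +
        2 / γ ^ 8 * (EN Ω w G (m + M) - EN Ω w G m)) := by
  set Z : ℝ := b₂ * (2 * (β * ((b₁ * b₂ ^ (r * m) : ℕ) : ℝ))) with hZ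
  have hZ0 : 0 ≤ Z := by positivity
  have h1 : ∀ φ : PMap Ω m, reg Ω w (regz Ω G φ) h ≤
      b₂ * (δ0 + (r : ℝ) ^ 2 * Z) + b₂ * (2 / γ ^ 8) *
      (EPhi Ω w M (fun Ψ => ∑ p ∈ (univ : Finset (Fin r)).offDiag, ∑ c ∈ G.C2 p.1 p.2,
        en Ω w G (app Ω φ Ψ) p.1 p.2 c) - ∑ p ∈ (univ : Finset (Fin r)).offDiag,
          ∑ c ∈ G.C2 p.1 p.2, en Ω w G φ p.1 p.2 c) := by
    intro φ
    refine (reg_bound (h := h) hr Ω w hw hw1 (regz Ω G φ) b₂ hG.2 γ δ0 hγ.le hδ0 hγδ).trans ?_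
    have h2 : ∑ p ∈ (univ : Finset (Fin r)).offDiag, bp Ω w (regz Ω G φ) γ p.1 p.2 ≤
        ∑ p ∈ (univ : Finset (Fin r)).offDiag, (Z + 2 / γ ^ 8 * ∑ c ∈ G.C2 p.1 p.2,
        (EPhi Ω w M (fun Ψ => en Ω w G (app Ω φ Ψ) p.1 p.2 c) - en Ω w G φ p.1 p.2 c)) :=
      Finset.sum_le_sum fun p hp => bp_bound Ω w hw hw1 G φ b₁ b₂ hb₂ hG γ β hγ hβ M hM p.1 p.2
        (by simpa using hp)
    rw [Finset.sum_add_distrib, Finset.sum_const, nsmul_eq_mul, ← Finset.mul_sum] at h2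
    simp only [Finset.sum_sub_distrib, ← EPhi_sum] at h2
    have h3 : ((univ : Finset (Fin r)).offDiag.card : ℝ) * Z ≤ (r : ℝ) ^ 2 * Z :=
      mul_le_mul_of_nonneg_right (card_offDiag_le r) hZ0
    rw [mul_assoc, ← mul_add]
    apply mul_le_mul_of_nonneg_left _ (Nat.cast_nonneg _)
    linarith
  refine (EPhi_mono Ω w hw m h1).trans (le_of_eq ?_)
  rw [EPhi_add, EPhi_const Ω w hw1, EPhi_cmul, EPhi_sub]
  unfold EN
  rw [EPhi_append]
  ring

lemma pigeon (f : ℕ → ℝ) (B : ℝ) (K : ℕ) (hK : 0 < K) (h0 : ∀ k, 0 ≤ f k) (hB : ∀ k, f k ≤ B) :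
    ∃ k < K, f (k + 1) - f k ≤ B / K := by
  by_contra hcon
  push Not at hcon
  have h1 : ∑ k ∈ Finset.range K, B / K < ∑ k ∈ Finset.range K, (f (k + 1) - f k) :=
    Finset.sum_lt_sum_of_nonempty (by simp; omega) fun k hk => hcon k (Finset.mem_range.1 hk)
  rw [Finset.sum_range_sub, Finset.sum_const, Finset.card_range, nsmul_eq_mul] at h1
  have hK' : (K : ℝ) ≠ 0 := by positivity
  rw [mul_div_cancel₀ _ hK'] at h1
  linarith [h0 0, hB K]

end final
end RL

/-- Regularity Lemma, Corollary. For any `r ≥ 2`, `h, b₁, b₂ ≥ 1`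
and `ε > 0` there is an integer `m̃` (depending only on `r, h, b₁, b₂, ε`) such that
for every `(b₁,b₂)`-colored `𝔯`-partite graph `G` on `Ω` there is an integer
`m ≤ m̃` with `E_{φ∈Φ(m)}[reg_h(G/φ)] ≤ ε`. -/
theorem regularity_lemma (r : ℕ) (hr : 2 ≤ r) (h b₁ b₂ : ℕ) (hh : 1 ≤ h)
    (hb₁ : 1 ≤ b₁) (hb₂ : 1 ≤ b₂) (ε : ℝ) (hε : 0 < ε) :
    ∃ mt : ℕ,
      ∀ (Ω : Fin r → Type) [∀ i, Fintype (Ω i)] [∀ i, Nonempty (Ω i)]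
        (w : ∀ i, Ω i → ℝ), (∀ i x, 0 ≤ w i x) → (∀ i, ∑ x : Ω i, w i x = 1) →
        ∀ (K₁ K₂ : Type) [Fintype K₁] [Fintype K₂] (G : CGraph Ω K₁ K₂),
          G.Bounded b₁ b₂ →
          ∃ m ≤ mt, EPhi Ω w m (fun φ => reg Ω w (regz Ω G φ) h) ≤ ε := by
  have hb₂' : (1 : ℝ) ≤ b₂ := by exact_mod_cast hb₂
  have hb₁' : (1 : ℝ) ≤ b₁ := by exact_mod_cast hb₁
  have hr' : (2 : ℝ) ≤ r := by exact_mod_cast hr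
  obtain ⟨δ0, hδ0, hδ1, hδε⟩ : ∃ δ0 : ℝ, 0 < δ0 ∧ δ0 ≤ 1 ∧ b₂ * δ0 ≤ ε / 3 := by
    refine ⟨min 1 (ε / (3 * b₂)), lt_min one_pos (by positivity), min_le_left _ _, ?_⟩
    calc (b₂ : ℝ) * min 1 (ε / (3 * b₂)) ≤ b₂ * (ε / (3 * b₂)) := by
          gcongr; exact min_le_right _ _
      _ = ε / 3 := by field_simp
  obtain ⟨N0, hN0⟩ : ∃ N0 : ℕ, N0 = r * (r * (h * h)) := ⟨_, rfl⟩
  have hN0pos : 0 < N0 := by rw [hN0]; positivity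
  obtain ⟨γ, hγ, hγδ⟩ : ∃ γ : ℝ, 0 < γ ∧
      ∀ n : ℕ, 1 ≤ n → n ≤ r * (r * (h * h)) → n * γ ≤ δ0 ^ n := by
    refine ⟨δ0 ^ N0 / N0, by positivity, ?_⟩
    intro n _ hn
    rw [← hN0] at hn
    have hn' : (n : ℝ) ≤ N0 := by exact_mod_cast hn
    calc (n : ℝ) * (δ0 ^ N0 / N0) ≤ N0 * (δ0 ^ N0 / N0) := by gcongr
      _ = δ0 ^ N0 := by field_simp
      _ ≤ δ0 ^ n := pow_le_pow_of_le_one hδ0.le hδ1 hn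
  obtain ⟨β, hβdef⟩ : ∃ β : ℕ → ℝ, ∀ m, β m =
      ε / (6 * b₂ ^ 2 * r ^ 2 * ((b₁ * b₂ ^ (r * m) : ℕ) : ℝ)) := ⟨_, fun _ => rfl⟩
  have hR : ∀ m, (0 : ℝ) < ((b₁ * b₂ ^ (r * m) : ℕ) : ℝ) := by
    intro m
    have : 0 < b₁ * b₂ ^ (r * m) := by positivity
    exact_mod_cast this
  have hβ : ∀ m, 0 < β m := by
    intro m
    rw [hβdef]
    have := hR m
    positivity
  obtain ⟨M, hM⟩ : ∃ M : ℕ → ℕ, ∀ m, 1 ≤ (M m : ℝ) * β m ^ 2 := by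
    refine ⟨fun m => ⌈1 / β m ^ 2⌉₊, fun m => ?_⟩
    have hp : 0 < β m ^ 2 := by have := hβ m; positivity
    rw [← div_le_iff₀ hp]
    exact Nat.le_ceil _
  obtain ⟨s, hs⟩ : ∃ s : ℕ → ℕ, ∀ k, s (k + 1) = s k + M (s k) :=
    ⟨fun k => Nat.rec 0 (fun _ x => x + M x) k, fun k => rfl⟩
  have hsm : Monotone s := monotone_nat_of_le_succ fun k => by rw [hs]; omega
  obtain ⟨K, hK⟩ := exists_nat_gt ((r : ℝ) ^ 2 * b₂ * (6 * b₂) / (ε * γ ^ 8))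
  have hKpos : (0 : ℝ) < K := lt_of_le_of_lt (by positivity) hK
  refine ⟨s K, ?_⟩
  intro Ω _ _ w hw hw1 K₁ K₂ _ _ G hG
  obtain ⟨k, hkK, hk⟩ := RL.pigeon (fun k => RL.EN Ω w G (s k)) ((r : ℝ) ^ 2 * b₂) K
    (by exact_mod_cast hKpos) (fun k => (RL.EN_bounds Ω w hw hw1 G b₁ b₂ hG (s k)).1)
    (fun k => (RL.EN_bounds Ω w hw hw1 G b₁ b₂ hG (s k)).2)
  refine ⟨s k, hsm hkK.le, ?_⟩
  simp only [hs] at hk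
  refine (RL.main_step (h := h) hr Ω w hw hw1 G b₁ b₂ hb₂ hG γ δ0 (β (s k)) hγ hδ0.le (hβ _) hγδ
    (s k) (M (s k)) (hM _)).trans ?_
  have e1 : (b₂ : ℝ) * ((r : ℝ) ^ 2 * (b₂ * (2 * (β (s k) * ((b₁ * b₂ ^ (r * s k) : ℕ) : ℝ)))))
      = ε / 3 := by
    rw [hβdef]
    have := hR (s k)
    generalize ((b₁ * b₂ ^ (r * s k) : ℕ) : ℝ) = R at *
    field_simp
    norm_num
  have e2 : (b₂ : ℝ) * (2 / γ ^ 8 * (RL.EN Ω w G (s k + M (s k)) - RL.EN Ω w G (s k))) ≤ ε / 3 := by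
    calc (b₂ : ℝ) * (2 / γ ^ 8 * (RL.EN Ω w G (s k + M (s k)) - RL.EN Ω w G (s k)))
        ≤ b₂ * (2 / γ ^ 8 * ((r : ℝ) ^ 2 * b₂ / K)) := by gcongr
      _ ≤ ε / 3 := by
        rw [div_lt_iff₀ (by positivity)] at hK
        have : (b₂ : ℝ) * (2 / γ ^ 8 * ((r : ℝ) ^ 2 * b₂ / K))
            = ((r : ℝ) ^ 2 * b₂ * (6 * b₂)) / (3 * (γ ^ 8 * K)) := by
          field_simp
          norm_num
        rw [this, div_le_div_iff₀ (by positivity) (by positivity)]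
        nlinarith
  rw [mul_add, mul_add, e1]
  linarith
end

section
/- Let h and m be positive integers, let G be a colored 𝔯-partite graph on Ω, let S ∈ S_{h,G} be such that d_G(S⟨v⟩) > 0 for every v ∈ 𝕍₁(S), and for each I ∈ binom(𝔯,2) and each e ∈ 𝕍_I(S) let F_e : C_I(G) → [−1,1] be a function; abbreviate F_e(G(e')) by F_e(e'). Let I ∈ binom(𝔯,2) and e₀ ∈ 𝕍_I(S), and suppose 1/m ≤ ∏_{v∈𝕍₁(S), v∉e₀} d_G(S⟨v⟩). Then ( E_{φ∈Φ(h)}[ ∏_{e∈𝕍₂(S)} F_e(φ(e)) | G(φ(v)) = S(v) for all v ∈ 𝕍₁(S) ] )² ≤ 2 · E_{ψ∈Φ(mh)} E_{e*∈Ω_I}[ ( E_{e∈Ω_I}[ F_{e₀}(e) | e ≈_{∂(G/ψ)} e* ] )² | G(∂e*) = S(∂e₀) ], where φ ∈ Φ(h) and ψ ∈ Φ(mh) are random. -/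
open Finset
open scoped BigOperators Classical

/-! ## Helper lemmas -/

lemma aux_resample {α β : Type} [Fintype α] [Fintype β] (u : α → ℝ) (W : β → ℝ)
    (g : β → α) (s : β → α → β) (hu : ∑ x, u x = 1)
    (h1 : ∀ b x, g (s b x) = x) (h2 : ∀ b x, s (s b x) (g b) = b)
    (h3 : ∀ b x, u x * W b = u (g b) * W (s b x)) (H : β → ℝ) :
    ∑ b, W b * H b = ∑ x, ∑ b, u x * (W b * H (s b x)) := by
  have e1 : ∑ b, W b * H b = ∑ p : α × β, u p.1 * (W p.2 * H p.2) := by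
    rw [Fintype.sum_prod_type]
    simp only [← Finset.mul_sum]
    rw [← Finset.sum_mul, hu, one_mul]
  rw [e1]
  rw [← Fintype.sum_prod_type (f := fun p : α × β => u p.1 * (W p.2 * H (s p.2 p.1)))]
  refine Finset.sum_nbij' (fun p => (g p.2, s p.2 p.1)) (fun p => (g p.2, s p.2 p.1))
    (by simp) (by simp) ?_ ?_ ?_
  · rintro ⟨x, b⟩ -; simp [h1, h2]
  · rintro ⟨x, b⟩ -; simp [h1, h2]
  · rintro ⟨x, b⟩ -
    simp only [h2]
    rw [← mul_assoc, h3, mul_assoc]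

/-- Replace the sample `a` in part `i` by `x`. -/
def upd {r h : ℕ} {Ω : Fin r → Type} (φ : PMap Ω h) (i : Fin r) (a : Fin h) (x : Ω i) :
    PMap Ω h :=
  Function.update φ i (Function.update (φ i) a x)

lemma upd_same {r h : ℕ} {Ω : Fin r → Type} (φ : PMap Ω h) (i : Fin r) (a : Fin h)
    (x : Ω i) : upd φ i a x i a = x := by
  simp [upd]

lemma upd_ne {r h : ℕ} {Ω : Fin r → Type} (φ : PMap Ω h) (i : Fin r) (a : Fin h)
    (x : Ω i) (j : Fin r) (b : Fin h) (hne : (j, b) ≠ (i, a)) : upd φ i a x j b = φ j b := by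
  unfold upd
  by_cases hj : j = i
  · subst hj
    have : b ≠ a := fun hb => hne (by rw [hb])
    simp [this]
  · simp [hj]

lemma upd_upd {r h : ℕ} {Ω : Fin r → Type} (φ : PMap Ω h) (i : Fin r) (a : Fin h)
    (x : Ω i) : upd (upd φ i a x) i a (φ i a) = φ := by
  simp [upd]

lemma weight_upd {r h : ℕ} (Ω : Fin r → Type) [∀ i, Fintype (Ω i)] (w : ∀ i, Ω i → ℝ)
    (φ : PMap Ω h) (i : Fin r) (a : Fin h) (x : Ω i) :
    w i x * pmapWeight Ω w φ = w i (φ i a) * pmapWeight Ω w (upd φ i a x) := by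
  unfold pmapWeight
  simp only [← Fintype.prod_prod_type (f := fun p : Fin r × Fin h => w p.1 (φ p.1 p.2)),
    ← Fintype.prod_prod_type (f := fun p : Fin r × Fin h => w p.1 (upd φ i a x p.1 p.2))]
  rw [← Finset.mul_prod_erase univ _ (Finset.mem_univ (i, a)),
    ← Finset.mul_prod_erase univ (fun p : Fin r × Fin h => w p.1 (upd φ i a x p.1 p.2))
      (Finset.mem_univ (i, a))]
  have : ∏ p ∈ univ.erase (i, a), w p.1 (upd φ i a x p.1 p.2) =
      ∏ p ∈ univ.erase (i, a), w p.1 (φ p.1 p.2) := by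
    refine Finset.prod_congr rfl fun p hp => ?_
    rw [upd_ne _ _ _ _ _ _ (Finset.ne_of_mem_erase hp)]
  rw [this]
  simp only [upd_same]
  ring

lemma resample {r h : ℕ} (Ω : Fin r → Type) [∀ i, Fintype (Ω i)] (w : ∀ i, Ω i → ℝ)
    (htot : ∀ i, ∑ x : Ω i, w i x = 1) (i : Fin r) (a : Fin h) (H : PMap Ω h → ℝ) :
    ∑ φ, pmapWeight Ω w φ * H φ =
      ∑ x, ∑ φ, w i x * (pmapWeight Ω w φ * H (upd φ i a x)) :=
  aux_resample (w i) (pmapWeight Ω w) (fun φ => φ i a) (fun φ x => upd φ i a x) (htot i)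
    (fun φ x => upd_same φ i a x) (fun φ x => upd_upd φ i a x)
    (fun φ x => weight_upd Ω w φ i a x) H

lemma resample2 {r h : ℕ} (Ω : Fin r → Type) [∀ i, Fintype (Ω i)] (w : ∀ i, Ω i → ℝ)
    (htot : ∀ i, ∑ x : Ω i, w i x = 1) (i j : Fin r) (a b : Fin h) (H : PMap Ω h → ℝ) :
    ∑ φ, pmapWeight Ω w φ * H φ =
      ∑ x, ∑ y, w i x * w j y *
        ∑ φ, pmapWeight Ω w φ * H (upd (upd φ i a x) j b y) := by
  rw [resample Ω w htot j b, Finset.sum_comm' (t' := univ) (s' := fun _ => univ) (by simp)]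
  have : ∀ φ : PMap Ω h, ∑ y, w j y * (pmapWeight Ω w φ * H (upd φ j b y)) =
      pmapWeight Ω w φ * ∑ y, w j y * H (upd φ j b y) := by
    intro φ
    rw [Finset.mul_sum]
    exact Finset.sum_congr rfl fun y _ => by ring
  simp only [this]
  rw [resample Ω w htot i a]
  refine Finset.sum_congr rfl fun x _ => ?_
  simp only [Finset.mul_sum]
  rw [Finset.sum_comm]
  refine Finset.sum_congr rfl fun y _ => Finset.sum_congr rfl fun φ _ => by ring

lemma sum_prod_pmap {r h : ℕ} (Ω : Fin r → Type) [∀ i, Fintype (Ω i)]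
    (f : ∀ i, Fin h → Ω i → ℝ) :
    ∑ φ : PMap Ω h, ∏ i, ∏ a, f i a (φ i a) = ∏ i, ∏ a, ∑ x, f i a x := by
  have h1 : ∀ i, ∏ a, ∑ x, f i a x = ∑ g : Fin h → Ω i, ∏ a, f i a (g a) := by
    intro i
    rw [Finset.prod_univ_sum]
    simp
  simp only [h1]
  rw [Finset.prod_univ_sum]
  simp

lemma weight_total {r h : ℕ} (Ω : Fin r → Type) [∀ i, Fintype (Ω i)] (w : ∀ i, Ω i → ℝ)
    (htot : ∀ i, ∑ x : Ω i, w i x = 1) : ∑ φ : PMap Ω h, pmapWeight Ω w φ = 1 := by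
  unfold pmapWeight
  rw [sum_prod_pmap Ω (fun i _ x => w i x)]
  simp [htot]

lemma weight_nonneg {r h : ℕ} (Ω : Fin r → Type) [∀ i, Fintype (Ω i)] (w : ∀ i, Ω i → ℝ)
    (hw : ∀ i x, 0 ≤ w i x) (φ : PMap Ω h) : 0 ≤ pmapWeight Ω w φ :=
  Finset.prod_nonneg fun _ _ => Finset.prod_nonneg fun _ _ => hw _ _

/-- The `k`-th copy of `Φ(h)` inside `Φ(mh)`. -/
def copyOf {r h m : ℕ} {Ω : Fin r → Type} (ψ : PMap Ω (m * h)) (k : Fin m) : PMap Ω h :=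
  fun i a => ψ i (finProdFinEquiv (k, a))

/-- `Φ(mh)` is `m` copies of `Φ(h)`. -/
def copyEquiv {r h m : ℕ} (Ω : Fin r → Type) : PMap Ω (m * h) ≃ (Fin m → PMap Ω h) where
  toFun ψ k := copyOf ψ k
  invFun Ψ i c := Ψ (finProdFinEquiv.symm c).1 i (finProdFinEquiv.symm c).2
  left_inv ψ := by
    funext i c
    simp only [copyOf, Prod.mk.eta, Equiv.apply_symm_apply]
  right_inv Ψ := by
    funext k i a
    simp only [copyOf, Equiv.symm_apply_apply]

lemma weight_copy {r h m : ℕ} (Ω : Fin r → Type) [∀ i, Fintype (Ω i)] (w : ∀ i, Ω i → ℝ)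
    (ψ : PMap Ω (m * h)) :
    pmapWeight Ω w ψ = ∏ k, pmapWeight Ω w (copyOf ψ k) := by
  unfold pmapWeight copyOf
  conv_rhs => rw [Finset.prod_comm]
  refine Finset.prod_congr rfl fun i _ => ?_
  rw [← Fintype.prod_prod_type
    (f := fun p : Fin m × Fin h => w i (ψ i (finProdFinEquiv (p.1, p.2))))]
  exact (Equiv.prod_comp finProdFinEquiv (fun c => w i (ψ i c))).symm

lemma sum_copies {r h m : ℕ} (Ω : Fin r → Type) [∀ i, Fintype (Ω i)] (w : ∀ i, Ω i → ℝ)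
    (f : Fin m → PMap Ω h → ℝ) :
    ∑ ψ : PMap Ω (m * h), pmapWeight Ω w ψ * ∏ k, f k (copyOf ψ k) =
      ∏ k, ∑ φ, pmapWeight Ω w φ * f k φ := by
  rw [Finset.prod_univ_sum]
  simp only [Fintype.piFinset_univ]
  rw [← Equiv.sum_comp (copyEquiv Ω)]
  refine Finset.sum_congr rfl fun ψ _ => ?_
  rw [weight_copy, ← Finset.prod_mul_distrib]
  rfl

lemma sum_copy_one {r h m : ℕ} (Ω : Fin r → Type) [∀ i, Fintype (Ω i)] (w : ∀ i, Ω i → ℝ)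
    (htot : ∀ i, ∑ x : Ω i, w i x = 1) (k : Fin m) (f : PMap Ω h → ℝ) :
    ∑ ψ : PMap Ω (m * h), pmapWeight Ω w ψ * f (copyOf ψ k) =
      ∑ φ, pmapWeight Ω w φ * f φ := by
  have := sum_copies Ω w (fun l φ => if l = k then f φ else 1)
  simp only [Finset.prod_ite_eq', Finset.mem_univ, if_true] at this
  rw [this, ← Finset.mul_prod_erase univ _ (Finset.mem_univ k)]
  rw [Finset.prod_eq_one]
  · simp
  · intro l hl
    simp [Finset.ne_of_mem_erase hl, weight_total Ω w htot]

lemma sum_copy_two {r h m : ℕ} (Ω : Fin r → Type) [∀ i, Fintype (Ω i)] (w : ∀ i, Ω i → ℝ)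
    (htot : ∀ i, ∑ x : Ω i, w i x = 1) (k l : Fin m) (hkl : k ≠ l) (f : PMap Ω h → ℝ) :
    ∑ ψ : PMap Ω (m * h), pmapWeight Ω w ψ * (f (copyOf ψ k) * f (copyOf ψ l)) =
      (∑ φ, pmapWeight Ω w φ * f φ) ^ 2 := by
  have := sum_copies Ω w (fun t φ => if t ∈ ({k, l} : Finset (Fin m)) then f φ else 1)
  simp only [Finset.prod_ite_mem, Finset.univ_inter] at this
  simp only [Finset.prod_pair hkl] at this
  rw [this, ← Finset.prod_subset (Finset.subset_univ ({k, l} : Finset (Fin m)))]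
  · rw [Finset.prod_pair hkl]
    simp [sq]
  · intro t _ ht
    simp only [if_neg ht, mul_one]
    exact weight_total Ω w htot

/-- Second moment bound for the number of successful copies. -/
lemma second_moment {r h m : ℕ} (Ω : Fin r → Type) [∀ i, Fintype (Ω i)] (w : ∀ i, Ω i → ℝ)
    (htot : ∀ i, ∑ x : Ω i, w i x = 1) (f : PMap Ω h → ℝ)
    (hf : ∀ φ, f φ * f φ = f φ) (p : ℝ) (hp : ∑ φ, pmapWeight Ω w φ * f φ = p)
    (hm : 1 ≤ (m : ℝ) * p) :
    ∑ ψ : PMap Ω (m * h), pmapWeight Ω w ψ * (∑ k, f (copyOf ψ k)) ^ 2 ≤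
      2 * (m * p) ^ 2 := by
  have e : ∑ ψ : PMap Ω (m * h), pmapWeight Ω w ψ * (∑ k, f (copyOf ψ k)) ^ 2 =
      ∑ k : Fin m, ∑ l : Fin m, ∑ ψ : PMap Ω (m * h),
        pmapWeight Ω w ψ * (f (copyOf ψ k) * f (copyOf ψ l)) := by
    simp only [sq, Finset.sum_mul_sum]
    simp only [Finset.mul_sum]
    rw [Finset.sum_comm]
    exact Finset.sum_congr rfl fun k _ => Finset.sum_comm
  have e2 : ∀ k l : Fin m, ∑ ψ : PMap Ω (m * h),
      pmapWeight Ω w ψ * (f (copyOf ψ k) * f (copyOf ψ l)) ≤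
        p ^ 2 + if k = l then p else 0 := by
    intro k l
    by_cases hkl : k = l
    · subst hkl
      simp only [hf, if_true]
      rw [sum_copy_one Ω w htot k f, hp]
      nlinarith [sq_nonneg p]
    · rw [sum_copy_two Ω w htot k l hkl, hp]
      simp [hkl]
  rw [e]
  calc _ ≤ ∑ k : Fin m, ∑ l : Fin m, (p ^ 2 + if k = l then p else 0) :=
        Finset.sum_le_sum fun k _ => Finset.sum_le_sum fun l _ => e2 k l
    _ = (m * p) ^ 2 + m * p := by
        simp [Finset.sum_add_distrib]; ring
    _ ≤ _ := by nlinarith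

/-- Replacing `F` by its conditional expectation. -/
lemma cond_replace {X C : Type} [Fintype X] (u F g : X → ℝ) (hu : ∀ x, 0 ≤ u x)
    (κ : X → C) (hg : ∀ x x', κ x = κ x' → g x = g x') :
    ∑ x, u x * (F x * g x) = ∑ x', u x' *
      (((∑ x, if κ x = κ x' then u x * F x else 0) / (∑ x, if κ x = κ x' then u x else 0))
        * g x') := by
  have e : ∀ x', u x' *
      (((∑ x, if κ x = κ x' then u x * F x else 0) / (∑ x, if κ x = κ x' then u x else 0))
        * g x') = ∑ x, if κ x = κ x' then
          u x' * (u x * (F x * g x)) / (∑ z, if κ z = κ x then u z else 0) else 0 := by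
    intro x'
    rw [Finset.sum_div, Finset.sum_mul, Finset.mul_sum]
    refine Finset.sum_congr rfl fun x _ => ?_
    by_cases hx : κ x = κ x'
    · rw [if_pos hx, if_pos hx, hx, hg x x' hx]
      ring
    · simp [hx]
  simp only [e]
  rw [Finset.sum_comm]
  refine Finset.sum_congr rfl fun x _ => ?_
  have e3 : ∀ x', (if κ x = κ x' then
          u x' * (u x * (F x * g x)) / (∑ z, if κ z = κ x then u z else 0) else 0) =
      (if κ x' = κ x then u x' else 0) *
        ((u x * (F x * g x)) / (∑ z, if κ z = κ x then u z else 0)) := by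
    intro x'
    by_cases hx : κ x = κ x'
    · rw [if_pos hx, if_pos hx.symm]; ring
    · rw [if_neg hx, if_neg (fun h => hx h.symm), zero_mul]
  simp only [e3]
  rw [← Finset.sum_mul]
  by_cases hU : (∑ z, if κ z = κ x then u z else 0) = 0
  · have : u x = 0 := by
      have := (Finset.sum_eq_zero_iff_of_nonneg (fun z _ => by split_ifs <;> simp [hu])).1 hU x
        (Finset.mem_univ x)
      simpa using this
    simp [this]
  · field_simp


lemma main_abstract {r h m : ℕ} (Ω : Fin r → Type) [∀ i, Fintype (Ω i)] (w : ∀ i, Ω i → ℝ)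
    (hw : ∀ i x, 0 ≤ w i x) (htot : ∀ i, ∑ x : Ω i, w i x = 1)
    {X C : Type} [Fintype X] (u c F₀ : X → ℝ) (hu : ∀ x, 0 ≤ u x) (hc0 : ∀ x, 0 ≤ c x)
    (R : PMap Ω h → X → ℝ) (hR : ∀ φ x, |R φ x| ≤ 1)
    (a : PMap Ω h → ℝ) (ha0 : ∀ φ, 0 ≤ a φ) (ha : ∀ φ, a φ * a φ = a φ)
    (p : ℝ) (hp : ∑ φ, pmapWeight Ω w φ * a φ = p) (hmp : 1 ≤ (m : ℝ) * p)
    (κ : PMap Ω (m * h) → X → C)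
    (hκc : ∀ ψ x x', κ ψ x = κ ψ x' → c x = c x')
    (hκR : ∀ ψ x x', κ ψ x = κ ψ x' → ∀ k, R (copyOf ψ k) x = R (copyOf ψ k) x') :
    (∑ x, u x * (c x * (F₀ x * ∑ φ, pmapWeight Ω w φ * (a φ * R φ x)))) ^ 2 ≤
      2 * (∑ x, u x * c x) * p ^ 2 * ∑ ψ : PMap Ω (m * h), pmapWeight Ω w ψ *
        ∑ x', u x' * (c x' * (((∑ x, if κ ψ x = κ ψ x' then u x * F₀ x else 0) /
          (∑ x, if κ ψ x = κ ψ x' then u x else 0)) ^ 2)) := by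
  set T : PMap Ω (m * h) → X → ℝ := fun ψ x' =>
    (∑ x, if κ ψ x = κ ψ x' then u x * F₀ x else 0) /
          (∑ x, if κ ψ x = κ ψ x' then u x else 0) with hT
  set N : PMap Ω (m * h) → X → ℝ := fun ψ x => ∑ k, a (copyOf ψ k) * R (copyOf ψ k) x with hN
  set Num := ∑ x, u x * (c x * (F₀ x * ∑ φ, pmapWeight Ω w φ * (a φ * R φ x))) with hNum
  have hmpos : (0 : ℝ) < m := by
    rcases Nat.eq_zero_or_pos m with h0 | h0
    · subst h0; norm_num at hmp
    · exact_mod_cast h0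
  have s1 : (m : ℝ) * Num = ∑ ψ : PMap Ω (m * h), pmapWeight Ω w ψ *
      ∑ x, u x * (F₀ x * (c x * N ψ x)) := by
    have t1 : ∀ x, ∑ ψ : PMap Ω (m * h), pmapWeight Ω w ψ * N ψ x =
        m * ∑ φ, pmapWeight Ω w φ * (a φ * R φ x) := by
      intro x
      simp only [hN, Finset.mul_sum]
      rw [Finset.sum_comm]
      simp only [sum_copy_one Ω w htot _ (fun φ => a φ * R φ x)]
      simp [Finset.mul_sum]
    simp only [hNum, Finset.mul_sum]
    conv_rhs => rw [Finset.sum_comm]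
    refine Finset.sum_congr rfl fun x _ => ?_
    have t2 := t1 x
    calc _ = u x * (c x * F₀ x) * (m * ∑ φ, pmapWeight Ω w φ * (a φ * R φ x)) := by
          simp only [Finset.mul_sum]
          exact Finset.sum_congr rfl fun φ _ => by ring
      _ = _ := by
          rw [← t2, Finset.mul_sum]
          exact Finset.sum_congr rfl fun φ _ => by ring
  have s2 : (m : ℝ) * Num = ∑ z : PMap Ω (m * h) × X,
      pmapWeight Ω w z.1 * (u z.2 * (T z.1 z.2 * (c z.2 * N z.1 z.2))) := by
    rw [s1, Fintype.sum_prod_type]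
    refine Finset.sum_congr rfl fun ψ _ => ?_
    rw [cond_replace u F₀ (fun x => c x * N ψ x) hu (κ ψ), Finset.mul_sum]
    intro x x' hx
    simp only [hN]
    rw [hκc ψ x x' hx]
    simp only [hκR ψ x x' hx]
  have hW : ∀ ψ : PMap Ω (m * h), 0 ≤ pmapWeight Ω w ψ := weight_nonneg Ω w hw
  have s3 := Finset.sum_sq_le_sum_mul_sum_of_sq_le_mul (univ : Finset (PMap Ω (m * h) × X))
    (r := fun z => pmapWeight Ω w z.1 * (u z.2 * (T z.1 z.2 * (c z.2 * N z.1 z.2))))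
    (f := fun z => pmapWeight Ω w z.1 * (u z.2 * (c z.2 * T z.1 z.2 ^ 2)))
    (g := fun z => pmapWeight Ω w z.1 * (u z.2 * (c z.2 * N z.1 z.2 ^ 2)))
    (fun z _ => mul_nonneg (hW _) (mul_nonneg (hu _) (mul_nonneg (hc0 _) (sq_nonneg _))))
    (fun z _ => mul_nonneg (hW _) (mul_nonneg (hu _) (mul_nonneg (hc0 _) (sq_nonneg _))))
    (fun z _ => le_of_eq (by ring))
  rw [← s2] at s3
  have s4 : ∑ z : PMap Ω (m * h) × X,
      pmapWeight Ω w z.1 * (u z.2 * (c z.2 * N z.1 z.2 ^ 2)) ≤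
      (∑ x, u x * c x) * (2 * (m * p) ^ 2) := by
    rw [Fintype.sum_prod_type, Finset.sum_comm, Finset.sum_mul]
    refine Finset.sum_le_sum fun x _ => ?_
    calc _ ≤ ∑ ψ : PMap Ω (m * h), (u x * c x) *
          (pmapWeight Ω w ψ * (∑ k, a (copyOf ψ k)) ^ 2) := by
          refine Finset.sum_le_sum fun ψ _ => ?_
          have hNb : |N ψ x| ≤ ∑ k, a (copyOf ψ k) := by
            refine (Finset.abs_sum_le_sum_abs _ _).trans (Finset.sum_le_sum fun k _ => ?_)
            rw [abs_mul, abs_of_nonneg (ha0 _)]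
            exact mul_le_of_le_one_right (ha0 _) (hR _ _)
          have hsq : N ψ x ^ 2 ≤ (∑ k, a (copyOf ψ k)) ^ 2 := by
            rw [← sq_abs (N ψ x)]
            gcongr
          have h4 := mul_le_mul_of_nonneg_left hsq
            (mul_nonneg (mul_nonneg (hu x) (hc0 x)) (hW ψ))
          show pmapWeight Ω w ψ * (u x * (c x * N ψ x ^ 2)) ≤ _
          linarith
      _ ≤ _ := by
          rw [← Finset.mul_sum]
          exact mul_le_mul_of_nonneg_left (second_moment Ω w htot a ha p hp hmp)
            (mul_nonneg (hu x) (hc0 x))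
  have s5 : ∑ z : PMap Ω (m * h) × X, pmapWeight Ω w z.1 * (u z.2 * (c z.2 * T z.1 z.2 ^ 2)) =
      ∑ ψ : PMap Ω (m * h), pmapWeight Ω w ψ * ∑ x', u x' * (c x' * T ψ x' ^ 2) := by
    rw [Fintype.sum_prod_type]
    simp only [Finset.mul_sum]
  rw [s5] at s3
  have hQ : 0 ≤ ∑ ψ : PMap Ω (m * h), pmapWeight Ω w ψ * ∑ x', u x' * (c x' * T ψ x' ^ 2) :=
    Finset.sum_nonneg fun ψ _ => mul_nonneg (hW ψ) (Finset.sum_nonneg fun x _ =>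
      mul_nonneg (hu _) (mul_nonneg (hc0 _) (sq_nonneg _)))
  have s6 := s3.trans (mul_le_mul_of_nonneg_left s4 hQ)
  refine le_of_mul_le_mul_left ?_ (pow_pos hmpos 2)
  refine le_of_eq_of_le (by ring) (s6.trans (le_of_eq (by ring)))


/-- Probability that the visible vertices in `B` get the right colors. -/
lemma prob_event {r h : ℕ} (Ω : Fin r → Type) [∀ i, Fintype (Ω i)] (w : ∀ i, Ω i → ℝ)
    (htot : ∀ i, ∑ x : Ω i, w i x = 1) {K₁ K₂ : Type} (G : CGraph Ω K₁ K₂)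
    (S : SComplex r h K₁ K₂) (B : Finset (Fin r × Fin h)) (hB : B ⊆ V1 S) :
    ∑ φ : PMap Ω h, pmapWeight Ω w φ *
      (if ∀ p ∈ B, some (G.vCol p.1 (φ p.1 p.2)) = S.vCol p.1 p.2 then (1 : ℝ) else 0) =
      ∏ p ∈ B, dVS Ω w G S p := by
  set f : ∀ i, Fin h → Ω i → ℝ := fun i a x =>
    w i x * (if (i, a) ∈ B then (if some (G.vCol i x) = S.vCol i a then 1 else 0) else 1) with hf
  have e1 : ∀ φ : PMap Ω h, pmapWeight Ω w φ *
      (if ∀ p ∈ B, some (G.vCol p.1 (φ p.1 p.2)) = S.vCol p.1 p.2 then (1 : ℝ) else 0) =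
      ∏ i, ∏ a, f i a (φ i a) := by
    intro φ
    simp only [hf, Finset.prod_mul_distrib]
    unfold pmapWeight
    congr 1
    rw [← Fintype.prod_prod_type (f := fun p : Fin r × Fin h =>
      if (p.1, p.2) ∈ B then
        (if some (G.vCol p.1 (φ p.1 p.2)) = S.vCol p.1 p.2 then (1 : ℝ) else 0) else 1)]
    simp only [Prod.mk.eta, Finset.prod_ite_mem, Finset.univ_inter]
    rw [Finset.prod_ite_zero]
    simp
  simp only [e1]
  rw [sum_prod_pmap Ω f, ← Fintype.prod_prod_type (f := fun p : Fin r × Fin h =>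
    ∑ x, f p.1 p.2 x), ← Finset.prod_subset (Finset.subset_univ B)]
  · refine Finset.prod_congr rfl fun p hp => ?_
    have hv : S.vCol p.1 p.2 ≠ none := by
      have := hB hp
      simpa [V1] using this
    obtain ⟨col, hcol⟩ := Option.ne_none_iff_exists'.1 hv
    simp only [hf, Prod.mk.eta, if_pos hp, dVS, hcol, dV]
    refine Finset.sum_congr rfl fun x _ => ?_
    simp
  · intro p _ hp
    simp only [hf, Prod.mk.eta, if_neg hp, mul_one, htot]

/-- Frame colors of `G/ψ` determine all edges to sampled copies. -/
lemma edge_inv {r h m : ℕ} (Ω : Fin r → Type) [∀ i, Fintype (Ω i)]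
    {K₁ K₂ : Type} [Fintype K₁] [Fintype K₂] (G : CGraph Ω K₁ K₂) (ψ : PMap Ω (m * h))
    (i : Fin r) (x x' : Ω i) (hx : (regz Ω G ψ).vCol i x = (regz Ω G ψ).vCol i x')
    (k : Fin m) (j : Fin r) (hj : j ≠ i) (b : Fin h) :
    G.eCol i j x (copyOf ψ k j b) = G.eCol i j x' (copyOf ψ k j b) := by
  have h2 := congrFun (congrFun (congrArg Prod.snd hx) j) (finProdFinEquiv (k, b))
  simpa [regz, hj, copyOf] using h2

lemma ite_inst (P : Prop) (d₁ d₂ : Decidable P) (x y : ℝ) :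
    @ite ℝ P d₁ x y = @ite ℝ P d₂ x y := by
  congr

/-- Lemma: mean square bounds correlation, conditioned form,
eq. (12). Under the additional assumptions that all visible vertex densities are
positive and `1/m ≤ ∏_{v∈𝕍₁(S), v∉e₀} d_G(S⟨v⟩)`:
`(E_{φ∈Φ(h)}[∏_{e∈𝕍₂(S)} F_e(φ(e)) | G(φ(v))=S(v) ∀v∈𝕍₁(S)])² ≤
 2 E_{ψ∈Φ(mh)} E_{e*∈Ω_I}[(E_{e∈Ω_I}[F_{e₀}(e) | e ≈_{∂(G/ψ)} e*])² | G(∂e*)=S(∂e₀)]`. -/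
theorem mean_square_bounds_correlation_cond {r : ℕ} (Ω : Fin r → Type)
    [∀ i, Fintype (Ω i)] [∀ i, Nonempty (Ω i)] (w : ∀ i, Ω i → ℝ)
    (hw : ∀ i x, 0 ≤ w i x) (htot : ∀ i, ∑ x : Ω i, w i x = 1)
    {K₁ K₂ : Type} [Fintype K₁] [Fintype K₂] (G : CGraph Ω K₁ K₂)
    (h m : ℕ) (hh : 1 ≤ h) (hm : 1 ≤ m)
    (S : SComplex r h K₁ K₂) (hS : S.MemS G)
    (hpos : ∀ p ∈ V1 S, 0 < dVS Ω w G S p)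
    (F : (Fin r × Fin r × Fin h × Fin h) → K₂ → ℝ)
    (hF : ∀ q ∈ V2 S, ∀ c ∈ G.C2 q.1 q.2.1, |F q c| ≤ 1)
    (i₀ j₀ : Fin r) (a₀ b₀ : Fin h) (he₀ : (i₀, j₀, a₀, b₀) ∈ V2 S)
    (hm' : (1 : ℝ) / m ≤ ∏ p ∈ ((V1 S).erase (i₀, a₀)).erase (j₀, b₀), dVS Ω w G S p) :
    (EPhiCond Ω w h (vEvent G S) (fun φ =>
        ∏ q ∈ V2 S, F q (G.eCol q.1 q.2.1 (φ q.1 q.2.2.1) (φ q.2.1 q.2.2.2)))) ^ 2 ≤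
      2 * EPhi Ω w (m * h) fun ψ =>
        condEE Ω w i₀ j₀
          (fun x' y' => some (G.vCol i₀ x') = S.vCol i₀ a₀ ∧
            some (G.vCol j₀ y') = S.vCol j₀ b₀)
          (fun x' y' =>
            (condEE Ω w i₀ j₀ (fun x y => frameRel Ω G ψ i₀ j₀ x y x' y')
              (fun x y => F (i₀, j₀, a₀, b₀) (G.eCol i₀ j₀ x y))) ^ 2) := by
  have hij : i₀ < j₀ := by
    have := he₀
    simp only [V2, mem_filter, mem_univ, true_and] at this
    exact this.1
  have huv : (i₀, a₀) ≠ (j₀, b₀) := fun hE => hij.ne (congrArg Prod.fst hE)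
  have hvis : S.eCol i₀ j₀ a₀ b₀ ≠ none := by
    have := he₀
    simp only [V2, mem_filter, mem_univ, true_and] at this
    exact this.2
  have hu1 : (i₀, a₀) ∈ V1 S := by
    simp only [V1, mem_filter, mem_univ, true_and]
    exact fun hn => hvis (S.down _ _ _ _ hn)
  have hv1 : (j₀, b₀) ∈ V1 S := by
    simp only [V1, mem_filter, mem_univ, true_and]
    exact fun hn => hvis (by rw [S.eSymm]; exact S.down _ _ _ _ hn)
  set B := ((V1 S).erase (i₀, a₀)).erase (j₀, b₀) with hBdef
  have hBsub : B ⊆ V1 S := (Finset.erase_subset _ _).trans (Finset.erase_subset _ _)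
  set p := ∏ q ∈ B, dVS Ω w G S q with hpdef
  have hm0 : (0 : ℝ) < m := by exact_mod_cast hm
  have hmp : 1 ≤ (m : ℝ) * p := by
    have := mul_le_mul_of_nonneg_left hm' hm0.le
    rwa [mul_one_div_cancel hm0.ne'] at this
  have hp0 : 0 < p := lt_of_lt_of_le (by positivity) hm'
  let U : PMap Ω h → Ω i₀ × Ω j₀ → PMap Ω h := fun φ z => upd (upd φ i₀ a₀ z.1) j₀ b₀ z.2
  have hUu : ∀ φ z, U φ z i₀ a₀ = z.1 := fun φ z => by
    show upd (upd φ i₀ a₀ z.1) j₀ b₀ z.2 i₀ a₀ = z.1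
    rw [upd_ne _ _ _ _ _ _ huv, upd_same]
  have hUv : ∀ φ z, U φ z j₀ b₀ = z.2 := fun φ z => upd_same _ _ _ _
  have hUo : ∀ φ z j b, (j, b) ≠ (i₀, a₀) → (j, b) ≠ (j₀, b₀) → U φ z j b = φ j b := by
    intro φ z j b h1 h2
    show upd (upd φ i₀ a₀ z.1) j₀ b₀ z.2 j b = φ j b
    rw [upd_ne _ _ _ _ _ _ h2, upd_ne _ _ _ _ _ _ h1]
  let u : Ω i₀ × Ω j₀ → ℝ := fun z => w i₀ z.1 * w j₀ z.2
  let cP : Ω i₀ × Ω j₀ → Prop := fun z =>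
    some (G.vCol i₀ z.1) = S.vCol i₀ a₀ ∧ some (G.vCol j₀ z.2) = S.vCol j₀ b₀
  let c : Ω i₀ × Ω j₀ → ℝ := fun z => if cP z then 1 else 0
  let A : PMap Ω h → Prop := fun φ => ∀ q ∈ B, some (G.vCol q.1 (φ q.1 q.2)) = S.vCol q.1 q.2
  let a : PMap Ω h → ℝ := fun φ => if A φ then 1 else 0
  let F₀ : Ω i₀ × Ω j₀ → ℝ := fun z => F (i₀, j₀, a₀, b₀) (G.eCol i₀ j₀ z.1 z.2)
  let R : PMap Ω h → Ω i₀ × Ω j₀ → ℝ := fun φ z => ∏ q ∈ (V2 S).erase (i₀, j₀, a₀, b₀),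
    F q (G.eCol q.1 q.2.1 (U φ z q.1 q.2.2.1) (U φ z q.2.1 q.2.2.2))
  let κ : PMap Ω (m * h) → Ω i₀ × Ω j₀ → (K₁ × (Fin r → Fin (m * h) → Option K₂)) ×
      (K₁ × (Fin r → Fin (m * h) → Option K₂)) := fun ψ z =>
    ((regz Ω G ψ).vCol i₀ z.1, (regz Ω G ψ).vCol j₀ z.2)
  have hev : ∀ φ z, vEvent G S (U φ z) ↔ A φ ∧ cP z := by
    intro φ z
    constructor
    · intro hE
      refine ⟨fun q hq => ?_, ?_, ?_⟩
      · have h1 := hE q (hBsub hq)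
        have hq1 : q ≠ (j₀, b₀) := Finset.ne_of_mem_erase hq
        have hq2 : q ≠ (i₀, a₀) := Finset.ne_of_mem_erase (Finset.mem_of_mem_erase hq)
        rwa [hUo φ z q.1 q.2 hq2 hq1] at h1
      · have h1 := hE _ hu1
        simpa only [hUu] using h1
      · have h1 := hE _ hv1
        simpa only [hUv] using h1
    · rintro ⟨hA, hc1, hc2⟩ q hq
      by_cases hq1 : q = (i₀, a₀)
      · subst hq1
        simpa only [hUu] using hc1
      by_cases hq2 : q = (j₀, b₀)
      · subst hq2
        simpa only [hUv] using hc2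
      rw [hUo φ z q.1 q.2 hq1 hq2]
      exact hA q (Finset.mem_erase.2 ⟨hq2, Finset.mem_erase.2 ⟨hq1, hq⟩⟩)
  have hac : ∀ φ z, (if vEvent G S (U φ z) then (1 : ℝ) else 0) = a φ * c z := by
    intro φ z
    simp only [hev, a, c]
    by_cases h1 : A φ <;> by_cases h2 : cP z <;> simp [h1, h2]
  have hR : ∀ φ z, |R φ z| ≤ 1 := by
    intro φ z
    simp only [R]
    rw [Finset.abs_prod]
    exact Finset.prod_le_one (fun _ _ => abs_nonneg _) fun q hq =>
      hF q (Finset.mem_of_mem_erase hq) _ (G.eMem _ _ _ _)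
  have hκc : ∀ ψ z z', κ ψ z = κ ψ z' → c z = c z' := by
    intro ψ z z' hz
    have h1 : G.vCol i₀ z.1 = G.vCol i₀ z'.1 := congrArg (fun t => t.1.1) hz
    have h2 : G.vCol j₀ z.2 = G.vCol j₀ z'.2 := congrArg (fun t => t.2.1) hz
    simp only [c, cP, h1, h2]
  have hκR : ∀ ψ z z', κ ψ z = κ ψ z' → ∀ k, R (copyOf ψ k) z = R (copyOf ψ k) z' := by
    intro ψ z z' hz k
    have hz1 : (regz Ω G ψ).vCol i₀ z.1 = (regz Ω G ψ).vCol i₀ z'.1 := congrArg Prod.fst hz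
    have hz2 : (regz Ω G ψ).vCol j₀ z.2 = (regz Ω G ψ).vCol j₀ z'.2 := congrArg Prod.snd hz
    refine Finset.prod_congr rfl fun q hq => ?_
    congr 1
    have hq0 : q ≠ (i₀, j₀, a₀, b₀) := Finset.ne_of_mem_erase hq
    have hq1 : q.1 < q.2.1 := by
      have := Finset.mem_of_mem_erase hq
      simp only [V2, mem_filter, mem_univ, true_and] at this
      exact this.1
    obtain ⟨i, j, s, t⟩ := q
    simp only at hq1 ⊢
    by_cases c1 : (i, s) = (i₀, a₀)
    · obtain ⟨rfl, rfl⟩ := Prod.mk.inj c1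
      have d1 : (j, t) ≠ (i, s) := fun hE => hq1.ne' (congrArg Prod.fst hE)
      have d2 : (j, t) ≠ (j₀, b₀) := by
        intro hE
        obtain ⟨rfl, rfl⟩ := Prod.mk.inj hE
        exact hq0 rfl
      rw [hUu, hUu, hUo _ _ _ _ d1 d2, hUo _ _ _ _ d1 d2]
      exact edge_inv Ω G ψ _ _ _ hz1 k j hq1.ne' t
    by_cases c2 : (i, s) = (j₀, b₀)
    · obtain ⟨rfl, rfl⟩ := Prod.mk.inj c2
      have d1 : (j, t) ≠ (i, s) := fun hE => hq1.ne' (congrArg Prod.fst hE)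
      have d2 : (j, t) ≠ (i₀, a₀) := fun hE => by
        have : j = i₀ := congrArg Prod.fst hE
        exact absurd (hij.trans hq1) (by rw [this]; exact lt_irrefl _)
      rw [hUv, hUv, hUo _ _ _ _ d2 d1, hUo _ _ _ _ d2 d1]
      exact edge_inv Ω G ψ _ _ _ hz2 k j hq1.ne' t
    rw [hUo _ _ _ _ c1 c2, hUo _ _ _ _ c1 c2]
    by_cases c3 : (j, t) = (i₀, a₀)
    · obtain ⟨rfl, rfl⟩ := Prod.mk.inj c3
      rw [hUu, hUu, G.eSymm, G.eSymm i]
      exact edge_inv Ω G ψ _ _ _ hz1 k i hq1.ne s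
    by_cases c4 : (j, t) = (j₀, b₀)
    · obtain ⟨rfl, rfl⟩ := Prod.mk.inj c4
      rw [hUv, hUv, G.eSymm, G.eSymm i]
      exact edge_inv Ω G ψ _ _ _ hz2 k i hq1.ne s
    rw [hUo _ _ _ _ c3 c4, hUo _ _ _ _ c3 c4]
  have hpa : ∑ φ, pmapWeight Ω w φ * a φ = p := prob_event Ω w htot G S B hBsub
  have key := main_abstract (m := m) Ω w hw htot u c F₀
    (fun z => mul_nonneg (hw _ _) (hw _ _))
    (fun z => by simp only [c]; split_ifs <;> norm_num) R hR a
    (fun φ => by simp only [a]; split_ifs <;> norm_num)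
    (fun φ => by simp only [a]; split_ifs <;> norm_num) p hpa hmp κ hκc hκR
  have hden : (∑ φ : PMap Ω h, if vEvent G S φ then pmapWeight Ω w φ else 0) =
      (∑ z, u z * c z) * p := by
    have e1 : ∀ φ : PMap Ω h, (if vEvent G S φ then pmapWeight Ω w φ else 0) =
        pmapWeight Ω w φ * (if vEvent G S φ then (1 : ℝ) else 0) := fun φ => by simp
    simp only [e1]
    rw [resample2 Ω w htot i₀ j₀ a₀ b₀, ← hpa, Fintype.sum_prod_type, Finset.sum_mul]
    refine Finset.sum_congr rfl fun x _ => ?_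
    rw [Finset.sum_mul]
    refine Finset.sum_congr rfl fun y _ => ?_
    have e2 : ∀ φ : PMap Ω h, (if vEvent G S (upd (upd φ i₀ a₀ x) j₀ b₀ y) then (1 : ℝ) else 0)
      = a φ * c (x, y) := fun φ => hac φ (x, y)
    simp only [e2, ← mul_assoc, ← Finset.sum_mul]
    simp only [u]
    ring
  have hnum : (∑ φ : PMap Ω h, if vEvent G S φ then pmapWeight Ω w φ *
      ∏ q ∈ V2 S, F q (G.eCol q.1 q.2.1 (φ q.1 q.2.2.1) (φ q.2.1 q.2.2.2)) else 0) =
      ∑ z, u z * (c z * (F₀ z * ∑ φ, pmapWeight Ω w φ * (a φ * R φ z))) := by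
    have e1 : ∀ φ : PMap Ω h, (if vEvent G S φ then pmapWeight Ω w φ *
        ∏ q ∈ V2 S, F q (G.eCol q.1 q.2.1 (φ q.1 q.2.2.1) (φ q.2.1 q.2.2.2)) else 0) =
        pmapWeight Ω w φ * ((if vEvent G S φ then (1 : ℝ) else 0) *
          ∏ q ∈ V2 S, F q (G.eCol q.1 q.2.1 (φ q.1 q.2.2.1) (φ q.2.1 q.2.2.2))) :=
      fun φ => by split_ifs <;> simp
    simp only [e1]
    rw [resample2 Ω w htot i₀ j₀ a₀ b₀, Fintype.sum_prod_type]
    refine Finset.sum_congr rfl fun x _ => Finset.sum_congr rfl fun y _ => ?_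
    show w i₀ x * w j₀ y * _ = w i₀ x * w j₀ y * _
    congr 1
    rw [Finset.mul_sum, Finset.mul_sum]
    refine Finset.sum_congr rfl fun φ _ => ?_
    have e2 : (if vEvent G S (upd (upd φ i₀ a₀ x) j₀ b₀ y) then (1 : ℝ) else 0)
      = a φ * c (x, y) := hac φ (x, y)
    have e3 : ∏ q ∈ V2 S, F q (G.eCol q.1 q.2.1 (U φ (x, y) q.1 q.2.2.1)
        (U φ (x, y) q.2.1 q.2.2.2)) = F₀ (x, y) * R φ (x, y) := by
      rw [← Finset.mul_prod_erase _ _ he₀]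
      simp only [hUu, hUv]
      rfl
    rw [e2]
    show _ * (_ * ∏ q ∈ V2 S, F q (G.eCol q.1 q.2.1 (U φ (x, y) q.1 q.2.2.1)
        (U φ (x, y) q.2.1 q.2.2.2))) = _
    rw [e3]
    ring
  set D := ∑ z, u z * c z with hD
  have hrhs : (EPhi Ω w (m * h) fun ψ =>
        condEE Ω w i₀ j₀
          (fun x' y' => some (G.vCol i₀ x') = S.vCol i₀ a₀ ∧
            some (G.vCol j₀ y') = S.vCol j₀ b₀)
          (fun x' y' =>
            (condEE Ω w i₀ j₀ (fun x y => frameRel Ω G ψ i₀ j₀ x y x' y')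
              (fun x y => F (i₀, j₀, a₀, b₀) (G.eCol i₀ j₀ x y))) ^ 2)) =
      (∑ ψ : PMap Ω (m * h), pmapWeight Ω w ψ *
        ∑ x', u x' * (c x' * (((∑ x, if κ ψ x = κ ψ x' then u x * F₀ x else 0) /
          (∑ x, if κ ψ x = κ ψ x' then u x else 0)) ^ 2))) / D := by
    unfold EPhi
    rw [Finset.sum_div]
    refine Finset.sum_congr rfl fun ψ _ => ?_
    rw [mul_div_assoc]
    congr 1
    beta_reduce
    rw [condEE]
    congr 1
    · rw [Fintype.sum_prod_type]
      refine Finset.sum_congr rfl fun x _ => Finset.sum_congr rfl fun y _ => ?_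
      have e4 : condEE Ω w i₀ j₀ (fun x' y' => frameRel Ω G ψ i₀ j₀ x' y' x y)
              (fun x y => F (i₀, j₀, a₀, b₀) (G.eCol i₀ j₀ x y)) =
          (∑ z, if κ ψ z = κ ψ (x, y) then u z * F₀ z else 0) /
          (∑ z, if κ ψ z = κ ψ (x, y) then u z else 0) := by
        rw [condEE, Fintype.sum_prod_type, Fintype.sum_prod_type]
        simp only [frameRel, κ, Prod.mk.injEq, u, F₀]
        congr 1
        · exact Finset.sum_congr rfl fun _ _ => Finset.sum_congr rfl fun _ _ =>
            ite_inst _ _ _ _ _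
        · exact Finset.sum_congr rfl fun _ _ => Finset.sum_congr rfl fun _ _ =>
            ite_inst _ _ _ _ _
      rw [e4]
      by_cases hcz : cP (x, y)
      · rw [if_pos hcz]
        simp only [c, if_pos hcz, u, one_mul]
      · rw [if_neg hcz]
        simp only [c, if_neg hcz, zero_mul, mul_zero]
    · rw [hD, Fintype.sum_prod_type]
      refine Finset.sum_congr rfl fun x _ => Finset.sum_congr rfl fun y _ => ?_
      by_cases hcz : cP (x, y)
      · rw [if_pos hcz]
        simp only [c, if_pos hcz, u, mul_one]
      · rw [if_neg hcz]
        simp only [c, if_neg hcz, mul_zero]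
  rw [hrhs, EPhiCond, hnum, hden]
  have hD0 : 0 ≤ D := Finset.sum_nonneg fun z _ => mul_nonneg
    (mul_nonneg (hw _ _) (hw _ _)) (by simp only [c]; split_ifs <;> norm_num)
  rcases hD0.eq_or_lt with hz | hDpos
  · rw [← hz]; simp
  rw [div_pow, div_le_iff₀ (by positivity)]
  refine key.trans (le_of_eq ?_)
  field_simp
  congr!
end
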